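/- arXiv:0811.1667 — 2 statements merged into one kernel-verified Lean document; each statement's English description precedes it below -/
import Mathlib

section
/- Let σ ∈ [0,1], l, m, l', m' ∈ ℝ with l' > l and m' > m, let E be a finite-dimensional normed vector space, and let a ∈ S_σ^{l,m}(ℝ^{2n}, E). Let ρ ∈ C_c^∞(ℝ^n, [0,1]) with ρ = 1 on the ball B(0,1) and ρ = 0 outside B(0,2). For p ∈ ℕ* define a_p(x, ϑ) := ρ(ϑ/p)·a(x, ϑ) if σ = 0, and a_p(x, ϑ) := ρ(x/p)ρ(ϑ/p)·a(x, ϑ) if σ > 0. Then each a_p belongs to S_σ^{l'',m''}(ℝ^{2n}, E) for all l'', m'' ∈ ℝ, and for every pair of multi-indices (α, β), sup_{(x,ϑ)∈ℝ^{2n}} ⟨x⟩^{σ(|α|-l')} ⟨ϑ⟩^{|β|-m'} ‖∂_x^α ∂_ϑ^β (a - a_p)(x, ϑ)‖ → 0 as p → ∞. -/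
open MeasureTheory
open scoped BigOperators

noncomputable section

/-- Japanese bracket `⟨v⟩ = (1 + ‖v‖²)^(1/2)` (with the Euclidean norm). -/
def jb {n : ℕ} (v : Fin n → ℝ) : ℝ := Real.sqrt (1 + ∑ i, (v i) ^ 2)

/-- Japanese bracket of a pair of vectors, `⟨(x,y)⟩`. -/
def jb2 {n m : ℕ} (x : Fin n → ℝ) (y : Fin m → ℝ) : ℝ :=
  Real.sqrt (1 + ∑ i, (x i) ^ 2 + ∑ j, (y j) ^ 2)

/-- Euclidean inner product `⟨ϑ, ζ⟩`. -/
def ip {n : ℕ} (ϑ ζ : Fin n → ℝ) : ℝ := ∑ i, ϑ i * ζ i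

/-- Partial derivative in the `i`-th coordinate direction. -/
def pd {n : ℕ} {E : Type*} [NormedAddCommGroup E] [NormedSpace ℝ E]
    (i : Fin n) (f : (Fin n → ℝ) → E) : (Fin n → ℝ) → E :=
  fun x => fderiv ℝ f x (Pi.single i 1)

/-- Iterated partial derivative `∂^ν` along the multi-index `ν`. -/
def pdm {n : ℕ} {E : Type*} [NormedAddCommGroup E] [NormedSpace ℝ E]
    (ν : Fin n → ℕ) (f : (Fin n → ℝ) → E) : (Fin n → ℝ) → E :=
  (List.finRange n).foldr (fun i g => (pd i)^[ν i] g) f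

/-- Mixed partial derivative `∂_x^α ∂_y^β` of a function of two vector variables. -/
def pdm2 {n m : ℕ} {E : Type*} [NormedAddCommGroup E] [NormedSpace ℝ E]
    (α : Fin n → ℕ) (β : Fin m → ℕ) (f : (Fin n → ℝ) → (Fin m → ℝ) → E) :
    (Fin n → ℝ) → (Fin m → ℝ) → E :=
  fun x y => pdm α (fun x' => pdm β (f x') y) x

/-- Mixed partial derivative `∂_x^α ∂_y^β ∂_z^γ` of a function of three vector variables. -/
def pdm3 {n m k : ℕ} {E : Type*} [NormedAddCommGroup E] [NormedSpace ℝ E]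
    (α : Fin n → ℕ) (β : Fin m → ℕ) (γ : Fin k → ℕ)
    (f : (Fin n → ℝ) → (Fin m → ℝ) → (Fin k → ℝ) → E) :
    (Fin n → ℝ) → (Fin m → ℝ) → (Fin k → ℝ) → E :=
  fun x y z => pdm α (fun x' => pdm β (fun y' => pdm γ (f x' y') z) y) x

/-- Length `|ν|` of a multi-index. -/
def msize {n : ℕ} (ν : Fin n → ℕ) : ℕ := ∑ i, ν i

/-- The class `G_σ(ℝ^n, E)`: smooth functions whose `ν`-th derivative is
`O(⟨v⟩^{-σ(|ν|-1)})` for every `ν ≠ 0`. -/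
def GsigmaCl {n : ℕ} {E : Type*} [NormedAddCommGroup E] [NormedSpace ℝ E]
    (σ : ℝ) (f : (Fin n → ℝ) → E) : Prop :=
  ContDiff ℝ (⊤ : ℕ∞) f ∧ ∀ ν : Fin n → ℕ, ν ≠ 0 → ∃ C > 0, ∀ v,
    ‖pdm ν f v‖ ≤ C * jb v ^ (-(σ * ((msize ν : ℝ) - 1)))

/-- The class `S_σ(ℝ^n)`: smooth real functions whose `ν`-th derivative is
`O(⟨v⟩^{-σ|ν|})` for every `ν`. -/
def SsigmaCl {n : ℕ} (σ : ℝ) (f : (Fin n → ℝ) → ℝ) : Prop :=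
  ContDiff ℝ (⊤ : ℕ∞) f ∧ ∀ ν : Fin n → ℕ, ∃ C > 0, ∀ v,
    |pdm ν f v| ≤ C * jb v ^ (-(σ * (msize ν : ℝ)))

/-- `G_σ^×(ℝ^p)`: diffeomorphisms `g` of `ℝ^p` with `g` and `g⁻¹` in `G_σ`. -/
def GsigmaX {p : ℕ} (σ : ℝ) (g : (Fin p → ℝ) → (Fin p → ℝ)) : Prop :=
  ∃ h : (Fin p → ℝ) → (Fin p → ℝ),
    Function.LeftInverse h g ∧ Function.RightInverse h g ∧ GsigmaCl σ g ∧ GsigmaCl σ h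

/-- The class `O_M(ℝ^n, E)`: smooth functions with polynomially bounded derivatives. -/
def OMCl {n : ℕ} {E : Type*} [NormedAddCommGroup E] [NormedSpace ℝ E]
    (f : (Fin n → ℝ) → E) : Prop :=
  ContDiff ℝ (⊤ : ℕ∞) f ∧ ∀ ν : Fin n → ℕ, ∃ C > 0, ∃ k : ℕ, ∀ v,
    ‖pdm ν f v‖ ≤ C * jb v ^ (k : ℝ)

/-- `O_M^×(ℝ^p, ℝ^p)`: diffeomorphisms `g` of `ℝ^p` with `g` and `g⁻¹` in `O_M`. -/
def OMX {p : ℕ} (g : (Fin p → ℝ) → (Fin p → ℝ)) : Prop :=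
  ∃ h : (Fin p → ℝ) → (Fin p → ℝ),
    Function.LeftInverse h g ∧ Function.RightInverse h g ∧ OMCl g ∧ OMCl h

/-- The symbol space `S_σ^{l,m}(ℝ^{2n}, E)`. -/
def Ssym {n : ℕ} {E : Type*} [NormedAddCommGroup E] [NormedSpace ℝ E]
    (σ l m : ℝ) (a : (Fin n → ℝ) → (Fin n → ℝ) → E) : Prop :=
  ContDiff ℝ (⊤ : ℕ∞) (fun q : (Fin n → ℝ) × (Fin n → ℝ) => a q.1 q.2) ∧
  ∀ α β : Fin n → ℕ, ∃ C > 0, ∀ x ϑ,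
    ‖pdm2 α β a x ϑ‖ ≤ C * jb x ^ (σ * (l - (msize α : ℝ))) * jb ϑ ^ (m - (msize β : ℝ))

/-- The amplitude space `Π_{σ,κ}^{l,w,m}(ℝ^{3n}, E)`. -/
def Amp {n : ℕ} {E : Type*} [NormedAddCommGroup E] [NormedSpace ℝ E]
    (σ κ l w m : ℝ) (a : (Fin n → ℝ) → (Fin n → ℝ) → (Fin n → ℝ) → E) : Prop :=
  ContDiff ℝ (⊤ : ℕ∞)
    (fun q : ((Fin n → ℝ) × (Fin n → ℝ)) × (Fin n → ℝ) => a q.1.1 q.1.2 q.2) ∧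
  ∀ α β γ : Fin n → ℕ, ∃ C > 0, ∀ x ζ ϑ,
    ‖pdm3 α β γ a x ζ ϑ‖ ≤
      C * jb x ^ (σ * (l - ((msize α + msize β : ℕ) : ℝ))) *
        jb ζ ^ (w + κ * ((msize α + msize β : ℕ) : ℝ)) * jb ϑ ^ (m - (msize γ : ℝ))

/-- The space `H_{σ,κ}^{w}(E)` of smooth functions on `ℝ^{2n}`. -/
def Hsp {n : ℕ} {F : Type*} [NormedAddCommGroup F] [NormedSpace ℝ F]
    (σ κ w : ℝ) (g : (Fin n → ℝ) → (Fin n → ℝ) → F) : Prop :=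
  ContDiff ℝ (⊤ : ℕ∞) (fun q : (Fin n → ℝ) × (Fin n → ℝ) => g q.1 q.2) ∧
  ∀ α β : Fin n → ℕ, ¬(α = 0 ∧ β = 0) → ∃ C > 0, ∀ x ζ,
    ‖pdm2 α β g x ζ‖ ≤ C * jb x ^ (-(σ * (((msize α + msize β : ℕ) : ℝ) - 1))) *
      jb ζ ^ (w + κ * (((msize α + msize β : ℕ) : ℝ) - 1))

/-- The space `E_{σ,κ}^{w}(E)` of smooth functions on `ℝ^{2n}`. -/
def Esp {n : ℕ} {F : Type*} [NormedAddCommGroup F] [NormedSpace ℝ F]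
    (σ κ w : ℝ) (g : (Fin n → ℝ) → (Fin n → ℝ) → F) : Prop :=
  ContDiff ℝ (⊤ : ℕ∞) (fun q : (Fin n → ℝ) × (Fin n → ℝ) => g q.1 q.2) ∧
  ∀ α β : Fin n → ℕ, ∃ C > 0, ∀ x ζ,
    ‖pdm2 α β g x ζ‖ ≤ C * jb x ^ (-(σ * ((msize α + msize β : ℕ) : ℝ))) *
      jb ζ ^ (w + κ * ((msize α + msize β : ℕ) : ℝ))

/-- Jacobian determinant of a map `ℝ^p → ℝ^p`. -/
def Jdet {p : ℕ} (g : (Fin p → ℝ) → (Fin p → ℝ)) : (Fin p → ℝ) → ℝ :=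
  fun v => LinearMap.det (fderiv ℝ g v).toLinearMap

/-- The seminorm `q_{p,(α,β)}(K) = sup ⟨(x,y)⟩^p |∂^{(α,β)} K (x,y)|`. -/
def qSem {n : ℕ} (p : ℕ) (α β : Fin n → ℕ)
    (K : (Fin n → ℝ) → (Fin n → ℝ) → ℂ) : ℝ :=
  ⨆ q : (Fin n → ℝ) × (Fin n → ℝ), jb2 q.1 q.2 ^ p * ‖pdm2 α β K q.1 q.2‖

/-- Mixed partial derivative `∂_r^α ∂_θ^β` of a function of two real variables. -/
def pd2 (α β : ℕ) (F : ℝ → ℝ → ℝ) (r θ : ℝ) : ℝ :=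
  iteratedDeriv α (fun r' => iteratedDeriv β (fun θ' => F r' θ') θ) r

/-- Smooth real function on `ℝ` with all derivatives bounded. -/
def BddSmooth (a : ℝ → ℝ) : Prop :=
  ContDiff ℝ (⊤ : ℕ∞) a ∧ ∀ k : ℕ, ∃ C : ℝ, ∀ t, |iteratedDeriv k a t| ≤ C

/-- Inverse hyperbolic cosine, `arcosh x = log (x + √(x²-1))`. -/
def arcosh (x : ℝ) : ℝ := Real.log (x + Real.sqrt (x ^ 2 - 1))


section helpers
open scoped ContDiff
open Filter Topology

variable {n : ℕ} {E : Type*} [NormedAddCommGroup E] [NormedSpace ℝ E]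

/-- Coordinate direction in the product space. -/
def bdir (v : Fin n ⊕ Fin n) : (Fin n → ℝ) × (Fin n → ℝ) :=
  match v with
  | Sum.inl i => (Pi.single i 1, 0)
  | Sum.inr i => (0, Pi.single i 1)

/-- Directional derivative on the product space. -/
def dd (v : Fin n ⊕ Fin n) (F : (Fin n → ℝ) × (Fin n → ℝ) → E) :
    (Fin n → ℝ) × (Fin n → ℝ) → E := fun q => fderiv ℝ F q (bdir v)

/-- Iterated directional derivative along a list of directions. -/
def dl : List (Fin n ⊕ Fin n) → ((Fin n → ℝ) × (Fin n → ℝ) → E) →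
    ((Fin n → ℝ) × (Fin n → ℝ) → E)
  | [], F => F
  | v :: L, F => dl L (dd v F)

/-- number of x-directions -/
def nx (L : List (Fin n ⊕ Fin n)) : ℕ := L.countP Sum.isLeft
/-- number of second-variable directions -/
def ny (L : List (Fin n ⊕ Fin n)) : ℕ := L.countP Sum.isRight

lemma dd_smooth {F : (Fin n → ℝ) × (Fin n → ℝ) → E} (hF : ContDiff ℝ (⊤ : ℕ∞) F)
    (v : Fin n ⊕ Fin n) : ContDiff ℝ (⊤ : ℕ∞) (dd v F) := by
  unfold dd
  exact (hF.fderiv_right (m := (⊤ : ℕ∞)) (by simp)).clm_apply contDiff_const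

lemma dl_smooth (L : List (Fin n ⊕ Fin n)) {F : (Fin n → ℝ) × (Fin n → ℝ) → E}
    (hF : ContDiff ℝ (⊤ : ℕ∞) F) : ContDiff ℝ (⊤ : ℕ∞) (dl L F) := by
  induction L generalizing F with
  | nil => exact hF
  | cons v L ih => exact ih (dd_smooth hF v)

lemma smooth_diff {V W : Type*} [NormedAddCommGroup V] [NormedSpace ℝ V] [NormedAddCommGroup W]
    [NormedSpace ℝ W] {F : V → W} (hF : ContDiff ℝ (⊤ : ℕ∞) F) :
    Differentiable ℝ F := hF.differentiable (by simp)

lemma dl_append (L M : List (Fin n ⊕ Fin n)) (F : (Fin n → ℝ) × (Fin n → ℝ) → E) :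
    dl (L ++ M) F = dl M (dl L F) := by
  induction L generalizing F with
  | nil => rfl
  | cons v L ih => exact ih _

lemma dl_replicate (k : ℕ) (v : Fin n ⊕ Fin n) (F : (Fin n → ℝ) × (Fin n → ℝ) → E) :
    dl (List.replicate k v) F = (dd v)^[k] F := by
  induction k generalizing F with
  | zero => rfl
  | succ k ih => simp only [List.replicate_succ, dl, Function.iterate_succ, Function.comp]; exact ih _

lemma dd_comm {F : (Fin n → ℝ) × (Fin n → ℝ) → E} (hF : ContDiff ℝ (⊤ : ℕ∞) F)
    (u v : Fin n ⊕ Fin n) : dd u (dd v F) = dd v (dd u F) := by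
  have hd : Differentiable ℝ (fderiv ℝ F) :=
    smooth_diff (hF.fderiv_right (m := (⊤ : ℕ∞)) (by simp))
  have key : ∀ (u v : Fin n ⊕ Fin n) q, dd u (dd v F) q = fderiv ℝ (fderiv ℝ F) q (bdir u) (bdir v) := by
    intro u v q
    unfold dd
    rw [fderiv_clm_apply (hd q) (differentiableAt_const _)]
    simp
  funext q
  rw [key, key]
  have : IsSymmSndFDerivAt ℝ F q := by
    apply ContDiffAt.isSymmSndFDerivAt (n := (⊤ : ℕ∞)) hF.contDiffAt
    rw [minSmoothness_of_isRCLikeNormedField]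
    exact WithTop.coe_le_coe.2 (le_top : (2 : ℕ∞) ≤ ⊤)
  exact this _ _

lemma dl_perm {L M : List (Fin n ⊕ Fin n)} (h : L.Perm M)
    {F : (Fin n → ℝ) × (Fin n → ℝ) → E} (hF : ContDiff ℝ (⊤ : ℕ∞) F) : dl L F = dl M F := by
  induction h generalizing F with
  | nil => rfl
  | cons v _ ih => exact ih (dd_smooth hF v)
  | swap u v L => simp only [dl]; rw [dd_comm hF]
  | trans _ _ ih1 ih2 => exact (ih1 hF).trans (ih2 hF)

lemma dl_add (L : List (Fin n ⊕ Fin n)) {F G : (Fin n → ℝ) × (Fin n → ℝ) → E}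
    (hF : ContDiff ℝ (⊤ : ℕ∞) F) (hG : ContDiff ℝ (⊤ : ℕ∞) G) :
    dl L (fun q => F q + G q) = fun q => dl L F q + dl L G q := by
  induction L generalizing F G with
  | nil => rfl
  | cons v L ih =>
    simp only [dl]
    rw [← ih (dd_smooth hF v) (dd_smooth hG v)]
    congr 1
    funext q
    simp only [dd]
    rw [fderiv_fun_add (smooth_diff hF q) (smooth_diff hG q)]
    rfl

lemma dl_sub (L : List (Fin n ⊕ Fin n)) {F G : (Fin n → ℝ) × (Fin n → ℝ) → E}
    (hF : ContDiff ℝ (⊤ : ℕ∞) F) (hG : ContDiff ℝ (⊤ : ℕ∞) G) :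
    dl L (fun q => F q - G q) = fun q => dl L F q - dl L G q := by
  induction L generalizing F G with
  | nil => rfl
  | cons v L ih =>
    simp only [dl]
    rw [← ih (dd_smooth hF v) (dd_smooth hG v)]
    congr 1
    funext q
    simp only [dd]
    rw [fderiv_fun_sub (smooth_diff hF q) (smooth_diff hG q)]
    rfl

lemma dl_congr (L : List (Fin n ⊕ Fin n)) {F G : (Fin n → ℝ) × (Fin n → ℝ) → E}
    {q : (Fin n → ℝ) × (Fin n → ℝ)} (h : F =ᶠ[𝓝 q] G) : dl L F =ᶠ[𝓝 q] dl L G := by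
  induction L generalizing F G with
  | nil => exact h
  | cons v L ih =>
    apply ih
    filter_upwards [h.fderiv (𝕜 := ℝ)] with y hy
    simp only [dd, hy]

lemma dl_zero (L : List (Fin n ⊕ Fin n)) :
    dl L (fun _ => (0 : E)) = fun _ => (0 : E) := by
  induction L with
  | nil => rfl
  | cons v L ih =>
    have : dd v (fun _ : (Fin n → ℝ) × (Fin n → ℝ) => (0 : E)) = fun _ => 0 := by
      funext q; simp [dd]
    simp only [dl]; rw [this, ih]

lemma dl_eq_zero (L : List (Fin n ⊕ Fin n)) {F : (Fin n → ℝ) × (Fin n → ℝ) → E}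
    {q : (Fin n → ℝ) × (Fin n → ℝ)} (h : ∀ᶠ y in 𝓝 q, F y = 0) : dl L F q = 0 := by
  have : F =ᶠ[𝓝 q] fun _ => (0 : E) := h
  have := (dl_congr L this).self_of_nhds
  rw [this, dl_zero]

lemma dl_scale (L : List (Fin n ⊕ Fin n)) {F : (Fin n → ℝ) × (Fin n → ℝ) → E}
    (hF : ContDiff ℝ (⊤ : ℕ∞) F) (c : ℝ) :
    dl L (fun q => F (c • q)) = fun q => c ^ L.length • dl L F (c • q) := by
  suffices H : ∀ k : ℝ, dl L (fun q => k • F (c • q)) = fun q => (k * c ^ L.length) • dl L F (c • q) by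
    simpa using H 1
  induction L generalizing F with
  | nil => intro k; simp [dl]
  | cons v L ih =>
    intro k
    simp only [dl]
    have : dd v (fun q => k • F (c • q)) = fun q => (k * c) • dd v F (c • q) := by
      funext q
      simp only [dd]
      have h1 : HasFDerivAt (fun q : (Fin n → ℝ) × (Fin n → ℝ) => c • q)
        (c • ContinuousLinearMap.id ℝ _) q := (hasFDerivAt_id q).const_smul c
      have h2 := ((smooth_diff hF (c • q)).hasFDerivAt.comp q h1).const_smul k
      have h3 := h2.fderiv
      change fderiv ℝ (fun q => k • F (c • q)) q = _ at h3
      rw [h3]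
      simp [mul_smul]
    rw [this, ih (dd_smooth hF v)]
    funext q
    rw [List.length_cons, pow_succ']
    ring_nf

lemma dl_comp (A : (Fin n → ℝ) × (Fin n → ℝ) →L[ℝ] (Fin n → ℝ)) (L : List (Fin n ⊕ Fin n))
    {ρ : (Fin n → ℝ) → E} (hs : ContDiff ℝ (⊤ : ℕ∞) ρ) (hc : HasCompactSupport ρ) :
    ∃ h : (Fin n → ℝ) → E, ContDiff ℝ (⊤ : ℕ∞) h ∧ HasCompactSupport h ∧
      dl L (fun q => ρ (A q)) = (fun q => h (A q)) ∧
      ((ρ = 0 ∨ ∃ v ∈ L, A (bdir v) = 0) → h = 0) := by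
  induction L generalizing ρ with
  | nil => exact ⟨ρ, hs, hc, rfl, by simp⟩
  | cons v L ih =>
    have e : dd v (fun q => ρ (A q)) = fun q => fderiv ℝ ρ (A q) (A (bdir v)) := by
      funext q
      have := ((smooth_diff hs (A q)).hasFDerivAt.comp q A.hasFDerivAt).fderiv
      change fderiv ℝ (fun q => ρ (A q)) q = _ at this
      simp [dd, this]
    obtain ⟨h, h1, h2, h3, h4⟩ := ih (ρ := fun y => fderiv ℝ ρ y (A (bdir v)))
      ((hs.fderiv_right (m := (⊤ : ℕ∞)) (by simp)).clm_apply contDiff_const)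
      (hc.fderiv_apply (𝕜 := ℝ) _)
    refine ⟨h, h1, h2, ?_, ?_⟩
    · simp only [dl]; rw [e, h3]
    · rintro (h0 | ⟨w, hw, hA⟩)
      · apply h4; left; funext y; subst h0; simp
      · rcases List.mem_cons.1 hw with rfl | hw
        · apply h4; left; funext y; simp [hA]
        · exact h4 (Or.inr ⟨w, hw, hA⟩)

/-- list of directions for the foldr -/
def lst (w : Fin n → Fin n ⊕ Fin n) (ν : Fin n → ℕ) : List (Fin n) → List (Fin n ⊕ Fin n)
  | [] => []
  | i :: is => lst w ν is ++ List.replicate (ν i) (w i)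

lemma dl_lst (w : Fin n → Fin n ⊕ Fin n) (ν : Fin n → ℕ) (is : List (Fin n))
    (F : (Fin n → ℝ) × (Fin n → ℝ) → E) :
    dl (lst w ν is) F = is.foldr (fun i G => (dd (w i))^[ν i] G) F := by
  induction is with
  | nil => rfl
  | cons i is ih => simp only [lst, dl_append, dl_replicate, List.foldr_cons, ih]

lemma iter_smooth (v : Fin n ⊕ Fin n) (k : ℕ) {F : (Fin n → ℝ) × (Fin n → ℝ) → E}
    (hF : ContDiff ℝ (⊤ : ℕ∞) F) : ContDiff ℝ (⊤ : ℕ∞) ((dd v)^[k] F) := by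
  rw [← dl_replicate]; exact dl_smooth _ hF

lemma pd_y {F : (Fin n → ℝ) × (Fin n → ℝ) → E} (hF : ContDiff ℝ (⊤ : ℕ∞) F) (i : Fin n)
    (x : Fin n → ℝ) : pd i (fun y => F (x, y)) = fun y => dd (Sum.inr i) F (x, y) := by
  funext y
  have h1 : HasFDerivAt (fun y : Fin n → ℝ => (x, y))
    (ContinuousLinearMap.inr ℝ (Fin n → ℝ) (Fin n → ℝ)) y := hasFDerivAt_prodMk_right x y
  have h2 := ((smooth_diff hF (x, y)).hasFDerivAt.comp y h1).fderiv
  change fderiv ℝ (fun y => F (x, y)) y = _ at h2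
  simp [pd, h2, dd, bdir]

lemma pd_x {F : (Fin n → ℝ) × (Fin n → ℝ) → E} (hF : ContDiff ℝ (⊤ : ℕ∞) F) (i : Fin n)
    (y : Fin n → ℝ) : pd i (fun x => F (x, y)) = fun x => dd (Sum.inl i) F (x, y) := by
  funext x
  have h1 : HasFDerivAt (fun x : Fin n → ℝ => (x, y))
    (ContinuousLinearMap.inl ℝ (Fin n → ℝ) (Fin n → ℝ)) x := hasFDerivAt_prodMk_left x y
  have h2 := ((smooth_diff hF (x, y)).hasFDerivAt.comp x h1).fderiv
  change fderiv ℝ (fun x => F (x, y)) x = _ at h2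
  simp [pd, h2, dd, bdir]

lemma pdit_y (i : Fin n) (k : ℕ) (x : Fin n → ℝ) {F : (Fin n → ℝ) × (Fin n → ℝ) → E}
    (hF : ContDiff ℝ (⊤ : ℕ∞) F) :
    (pd i)^[k] (fun y => F (x, y)) = fun y => ((dd (Sum.inr i))^[k] F) (x, y) := by
  induction k generalizing F with
  | zero => rfl
  | succ k ih =>
    simp only [Function.iterate_succ, Function.comp]
    rw [pd_y hF, ih (dd_smooth hF _)]

lemma pdit_x (i : Fin n) (k : ℕ) (y : Fin n → ℝ) {F : (Fin n → ℝ) × (Fin n → ℝ) → E}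
    (hF : ContDiff ℝ (⊤ : ℕ∞) F) :
    (pd i)^[k] (fun x => F (x, y)) = fun x => ((dd (Sum.inl i))^[k] F) (x, y) := by
  induction k generalizing F with
  | zero => rfl
  | succ k ih =>
    simp only [Function.iterate_succ, Function.comp]
    rw [pd_x hF, ih (dd_smooth hF _)]

lemma pdm_y (ν : Fin n → ℕ) (x : Fin n → ℝ) {F : (Fin n → ℝ) × (Fin n → ℝ) → E}
    (hF : ContDiff ℝ (⊤ : ℕ∞) F) :
    pdm ν (fun y => F (x, y)) = fun y => dl (lst Sum.inr ν (List.finRange n)) F (x, y) := by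
  unfold pdm
  generalize List.finRange n = is
  induction is with
  | nil => rfl
  | cons i is ih =>
    simp only [List.foldr_cons]
    rw [ih, pdit_y i (ν i) x (dl_smooth _ hF)]
    simp only [lst, dl_append, dl_replicate]

lemma pdm_x (ν : Fin n → ℕ) (y : Fin n → ℝ) {F : (Fin n → ℝ) × (Fin n → ℝ) → E}
    (hF : ContDiff ℝ (⊤ : ℕ∞) F) :
    pdm ν (fun x => F (x, y)) = fun x => dl (lst Sum.inl ν (List.finRange n)) F (x, y) := by
  unfold pdm
  generalize List.finRange n = is
  induction is with
  | nil => rfl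
  | cons i is ih =>
    simp only [List.foldr_cons]
    rw [ih, pdit_x i (ν i) y (dl_smooth _ hF)]
    simp only [lst, dl_append, dl_replicate]

/-- the list of directions of a pair of multi-indices -/
def lab (α β : Fin n → ℕ) : List (Fin n ⊕ Fin n) :=
  lst Sum.inr β (List.finRange n) ++ lst Sum.inl α (List.finRange n)

lemma pdm2_eq (α β : Fin n → ℕ) {f : (Fin n → ℝ) → (Fin n → ℝ) → E}
    (hf : ContDiff ℝ (⊤ : ℕ∞) (fun q : (Fin n → ℝ) × (Fin n → ℝ) => f q.1 q.2))
    (x y : Fin n → ℝ) :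
    pdm2 α β f x y = dl (lab α β) (fun q => f q.1 q.2) (x, y) := by
  unfold pdm2 lab
  have h : ∀ x', pdm β (f x') y = dl (lst Sum.inr β (List.finRange n)) (fun q => f q.1 q.2) (x', y) :=
    fun x' => congrFun (pdm_y β x' hf) y
  simp only [h]
  rw [pdm_x α y (dl_smooth _ hf), dl_append]

lemma nx_append (L M : List (Fin n ⊕ Fin n)) : nx (L ++ M) = nx L + nx M := by
  simp [nx]
lemma ny_append (L M : List (Fin n ⊕ Fin n)) : ny (L ++ M) = ny L + ny M := by
  simp [ny]

lemma nx_lst_inl (ν : Fin n → ℕ) (is) : nx (lst Sum.inl ν is) = (is.map ν).sum := by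
  induction is with
  | nil => rfl
  | cons i is ih => rw [lst, nx_append, ih]; simp [nx, List.countP_replicate, add_comm]
lemma nx_lst_inr (ν : Fin n → ℕ) (is) : nx (lst Sum.inr ν is) = 0 := by
  induction is with
  | nil => rfl
  | cons i is ih => rw [lst, nx_append, ih]; simp [nx, List.countP_replicate]
lemma ny_lst_inr (ν : Fin n → ℕ) (is) : ny (lst Sum.inr ν is) = (is.map ν).sum := by
  induction is with
  | nil => rfl
  | cons i is ih => rw [lst, ny_append, ih]; simp [ny, List.countP_replicate, add_comm]
lemma ny_lst_inl (ν : Fin n → ℕ) (is) : ny (lst Sum.inl ν is) = 0 := by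
  induction is with
  | nil => rfl
  | cons i is ih => rw [lst, ny_append, ih]; simp [ny, List.countP_replicate]

lemma nx_lab (α β : Fin n → ℕ) : nx (lab α β) = msize α := by
  rw [lab, nx_append, nx_lst_inl, nx_lst_inr, msize, Fin.sum_univ_def, zero_add]
lemma ny_lab (α β : Fin n → ℕ) : ny (lab α β) = msize β := by
  rw [lab, ny_append, ny_lst_inl, ny_lst_inr, msize, Fin.sum_univ_def, add_zero]

instance lawful_sum : LawfulBEq (Fin n ⊕ Fin n) where
  eq_of_beq := by
    rintro (a | a) (b | b) h
    · exact congrArg Sum.inl (eq_of_beq (α := Fin n) h)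
    · exact absurd h Bool.false_ne_true
    · exact absurd h Bool.false_ne_true
    · exact congrArg Sum.inr (eq_of_beq (α := Fin n) h)
  rfl := by
    rintro (a | a)
    · exact beq_self_eq_true (α := Fin n) a
    · exact beq_self_eq_true (α := Fin n) a

lemma count_lst (w : Fin n → Fin n ⊕ Fin n) (hw : Function.Injective w) (ν : Fin n → ℕ)
    (is : List (Fin n)) (hn : is.Nodup) (j : Fin n) :
    (lst w ν is).count (w j) = if j ∈ is then ν j else 0 := by
  induction is with
  | nil => simp [lst]
  | cons i is ih =>
    rw [List.nodup_cons] at hn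
    rw [lst, List.count_append, ih hn.2, List.count_replicate]
    by_cases h : i = j
    · subst h; simp [hn.1]
    · have h' : ¬ j = i := fun e => h e.symm
      have : ¬ w i = w j := fun e => h (hw e)
      simp [h', this]

lemma count_lst' (w : Fin n → Fin n ⊕ Fin n) (ν : Fin n → ℕ) (v : Fin n ⊕ Fin n)
    (hv : ∀ i, w i ≠ v) (is : List (Fin n)) : (lst w ν is).count v = 0 := by
  induction is with
  | nil => simp [lst]
  | cons i is ih =>
    rw [lst, List.count_append, ih, List.count_replicate]
    simp [hv]

lemma perm_lab (L : List (Fin n ⊕ Fin n)) :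
    L.Perm (lab (fun i => L.count (Sum.inl i)) (fun i => L.count (Sum.inr i))) := by
  rw [List.perm_iff_count]
  rintro (j | j)
  · rw [lab, List.count_append, count_lst' Sum.inr _ _ (by simp),
      count_lst Sum.inl Sum.inl_injective _ _ (List.nodup_finRange n)]
    simp
  · rw [lab, List.count_append, count_lst' Sum.inl _ _ (by simp),
      count_lst Sum.inr Sum.inr_injective _ _ (List.nodup_finRange n)]
    simp

lemma nx_perm {L M : List (Fin n ⊕ Fin n)} (h : L.Perm M) : nx L = nx M := h.countP_eq _
lemma ny_perm {L M : List (Fin n ⊕ Fin n)} (h : L.Perm M) : ny L = ny M := h.countP_eq _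

/-- uniform symbol bounds for a family -/
def Fam (σ l m : ℝ) (f : ℕ → (Fin n → ℝ) × (Fin n → ℝ) → E) : Prop :=
  (∀ p, ContDiff ℝ (⊤ : ℕ∞) (f p)) ∧ ∀ L : List (Fin n ⊕ Fin n), ∃ C : ℝ, 0 < C ∧
    ∀ p, 1 ≤ p → ∀ q, ‖dl L (f p) q‖ ≤
      C * jb q.1 ^ (σ * (l - (nx L : ℝ))) * jb q.2 ^ (m - (ny L : ℝ))

lemma jb_ge (v : Fin n → ℝ) : 1 ≤ jb v := by
  unfold jb
  rw [Real.one_le_sqrt]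
  have : 0 ≤ ∑ i, (v i) ^ 2 := Finset.sum_nonneg fun i _ => sq_nonneg _
  linarith
lemma jb_pos (v : Fin n → ℝ) : 0 < jb v := lt_of_lt_of_le one_pos (jb_ge v)

lemma fam_const {σ l m : ℝ} {a : (Fin n → ℝ) → (Fin n → ℝ) → E} (ha : Ssym σ l m a) :
    Fam σ l m (fun _ q => a q.1 q.2) := by
  refine ⟨fun _ => ha.1, fun L => ?_⟩
  obtain ⟨C, hC, h⟩ := ha.2 (fun i => L.count (Sum.inl i)) (fun i => L.count (Sum.inr i))
  refine ⟨C, hC, fun p _ q => ?_⟩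
  rw [dl_perm (perm_lab L) ha.1, nx_perm (perm_lab L), ny_perm (perm_lab L), nx_lab, ny_lab]
  have := h q.1 q.2
  rwa [pdm2_eq _ _ ha.1] at this

lemma fam_dd {σ l m : ℝ} {f : ℕ → (Fin n → ℝ) × (Fin n → ℝ) → E} (hf : Fam σ l m f)
    (v : Fin n ⊕ Fin n) : Fam σ (l - nx [v]) (m - ny [v]) (fun p => dd v (f p)) := by
  refine ⟨fun p => dd_smooth (hf.1 p) v, fun L => ?_⟩
  obtain ⟨C, hC, h⟩ := hf.2 (v :: L)
  refine ⟨C, hC, fun p hp q => ?_⟩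
  have := h p hp q
  have e1 : nx (v :: L) = nx [v] + nx L := nx_append [v] L
  have e2 : ny (v :: L) = ny [v] + ny L := ny_append [v] L
  rw [e1, e2] at this
  push_cast at this
  rw [sub_sub, sub_sub]
  exact this

lemma fam_mul (L : List (Fin n ⊕ Fin n)) : ∀ {σ l m l' m' : ℝ}
    {f : ℕ → (Fin n → ℝ) × (Fin n → ℝ) → ℝ} {g : ℕ → (Fin n → ℝ) × (Fin n → ℝ) → E}
    (hf : Fam σ l m f) (hg : Fam σ l' m' g),
    ∃ C : ℝ, 0 < C ∧ ∀ p, 1 ≤ p → ∀ q, ‖dl L (fun q => f p q • g p q) q‖ ≤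
      C * jb q.1 ^ (σ * (l + l' - (nx L : ℝ))) * jb q.2 ^ (m + m' - (ny L : ℝ)) := by
  induction L with
  | nil =>
    intro σ l m l' m' f g hf hg
    obtain ⟨C, hC, h⟩ := hf.2 []
    obtain ⟨C', hC', h'⟩ := hg.2 []
    refine ⟨C * C', by positivity, fun p hp q => ?_⟩
    have := mul_le_mul (h p hp q) (h' p hp q) (norm_nonneg _) ((norm_nonneg _).trans (h p hp q))
    simp only [dl] at this ⊢
    rw [norm_smul]
    refine this.trans (le_of_eq ?_)
    have e1 : σ * (l + l' - (nx ([] : List (Fin n ⊕ Fin n)) : ℝ)) = σ * (l - (nx ([] : List (Fin n ⊕ Fin n)) : ℝ)) + σ * (l' - (nx ([] : List (Fin n ⊕ Fin n)) : ℝ)) := by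
      simp [nx]; ring
    have e2 : (m + m' - (ny ([] : List (Fin n ⊕ Fin n)) : ℝ)) = (m - (ny ([] : List (Fin n ⊕ Fin n)) : ℝ)) + (m' - (ny ([] : List (Fin n ⊕ Fin n)) : ℝ)) := by
      simp [ny]
    rw [e1, e2, Real.rpow_add (jb_pos _), Real.rpow_add (jb_pos _)]
    ring
  | cons v L ih =>
    intro σ l m l' m' f g hf hg
    obtain ⟨C, hC, h⟩ := ih (fam_dd hf v) hg
    obtain ⟨C', hC', h'⟩ := ih hf (fam_dd hg v)
    refine ⟨C' + C, by positivity, fun p hp q => ?_⟩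
    have e : dd v (fun q => f p q • g p q) =
        fun q => f p q • dd v (g p) q + dd v (f p) q • g p q := by
      funext q
      simp only [dd]
      rw [fderiv_fun_smul (smooth_diff (hf.1 p) q) (smooth_diff (hg.1 p) q)]
      simp
    simp only [dl]
    have s1 : ContDiff ℝ (⊤ : ℕ∞) (fun q => f p q • dd v (g p) q) :=
      (hf.1 p).smul (dd_smooth (hg.1 p) v)
    have s2 : ContDiff ℝ (⊤ : ℕ∞) (fun q => dd v (f p) q • g p q) :=
      (dd_smooth (hf.1 p) v).smul (hg.1 p)
    rw [e, dl_add L s1 s2]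
    refine (norm_add_le _ _).trans ((add_le_add (h' p hp q) (h p hp q)).trans (le_of_eq ?_))
    have e1 : nx (v :: L) = nx [v] + nx L := nx_append [v] L
    have e2 : ny (v :: L) = ny [v] + ny L := ny_append [v] L
    rw [e1, e2]
    push_cast
    rw [show l + (l' - (nx [v] : ℝ)) - nx L = l + l' - (nx [v] + nx L) by ring,
      show m + (m' - (ny [v] : ℝ)) - ny L = m + m' - (ny [v] + ny L) by ring,
      show l - (nx [v] : ℝ) + l' - nx L = l + l' - (nx [v] + nx L) by ring,
      show m - (ny [v] : ℝ) + m' - ny L = m + m' - (ny [v] + ny L) by ring]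
    ring

lemma fam_smul {σ l m l' m' : ℝ}
    {f : ℕ → (Fin n → ℝ) × (Fin n → ℝ) → ℝ} {g : ℕ → (Fin n → ℝ) × (Fin n → ℝ) → E}
    (hf : Fam σ l m f) (hg : Fam σ l' m' g) :
    Fam σ (l + l') (m + m') (fun p q => f p q • g p q) :=
  ⟨fun p => (hf.1 p).smul (hg.1 p), fun L => fam_mul L hf hg⟩

lemma jb_sq (v : Fin n → ℝ) : jb v ^ 2 = 1 + ∑ i, (v i) ^ 2 := by
  unfold jb
  rw [Real.sq_sqrt]
  have : 0 ≤ ∑ i, (v i) ^ 2 := Finset.sum_nonneg fun i _ => sq_nonneg _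
  linarith

lemma sum_scale (c : ℝ) (v : Fin n → ℝ) : ∑ i, ((c • v) i) ^ 2 = c ^ 2 * ∑ i, (v i) ^ 2 := by
  simp [mul_pow, Finset.mul_sum]

lemma cut_zero {ρ : (Fin n → ℝ) → ℝ}
    (hρ0 : ∀ x : Fin n → ℝ, (4 : ℝ) ≤ ∑ i, (x i) ^ 2 → ρ x = 0) {p : ℕ} (hp : 1 ≤ p)
    (A : (Fin n → ℝ) × (Fin n → ℝ) →L[ℝ] (Fin n → ℝ)) (q : (Fin n → ℝ) × (Fin n → ℝ))
    (hq : 3 * (p : ℝ) < jb (A q)) : ∀ᶠ y in 𝓝 q, ρ ((p : ℝ)⁻¹ • A y) = 0 := by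
  have hp' : (1 : ℝ) ≤ p := by exact_mod_cast hp
  have h1 : Continuous fun y => jb (A y) := by unfold jb; fun_prop
  have h2 : ∀ᶠ y in 𝓝 q, 3 * (p : ℝ) < jb (A y) := h1.continuousAt.eventually_const_lt hq
  filter_upwards [h2] with y hy
  apply hρ0
  rw [sum_scale, inv_pow, ← div_eq_inv_mul, le_div_iff₀ (by positivity)]
  have := jb_sq (A y)
  nlinarith

lemma cut_one {ρ : (Fin n → ℝ) → ℝ}
    (hρ1 : ∀ x : Fin n → ℝ, (∑ i, (x i) ^ 2) < 1 → ρ x = 1) {p : ℕ} (hp : 1 ≤ p)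
    (A : (Fin n → ℝ) × (Fin n → ℝ) →L[ℝ] (Fin n → ℝ)) (q : (Fin n → ℝ) × (Fin n → ℝ))
    (hq : jb (A q) < p) : ∀ᶠ y in 𝓝 q, ρ ((p : ℝ)⁻¹ • A y) = 1 := by
  have hp' : (1 : ℝ) ≤ p := by exact_mod_cast hp
  have h1 : Continuous fun y => jb (A y) := by unfold jb; fun_prop
  have h2 : ∀ᶠ y in 𝓝 q, jb (A y) < p := h1.continuousAt.eventually_lt_const hq
  filter_upwards [h2] with y hy
  apply hρ1
  rw [sum_scale, inv_pow, ← div_eq_inv_mul, div_lt_one (by positivity)]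
  have := jb_sq (A y)
  have := jb_pos (A y)
  nlinarith

lemma cut_bound {ρ : (Fin n → ℝ) → ℝ} (hρs : ContDiff ℝ (⊤ : ℕ∞) ρ) (hρc : HasCompactSupport ρ)
    (hρ0 : ∀ x : Fin n → ℝ, (4 : ℝ) ≤ ∑ i, (x i) ^ 2 → ρ x = 0)
    (A : (Fin n → ℝ) × (Fin n → ℝ) →L[ℝ] (Fin n → ℝ)) (L : List (Fin n ⊕ Fin n)) :
    ∃ C : ℝ, 0 < C ∧ ∀ p : ℕ, 1 ≤ p → ∀ q,
      ‖dl L (fun q => ρ ((p : ℝ)⁻¹ • A q)) q‖ ≤ C * jb (A q) ^ (-(L.length : ℝ)) ∧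
      ((∃ v ∈ L, A (bdir v) = 0) → dl L (fun q => ρ ((p : ℝ)⁻¹ • A q)) q = 0) := by
  obtain ⟨h, h1, h2, h3, h4⟩ := dl_comp A L hρs hρc
  obtain ⟨M, hM⟩ := h2.exists_bound_of_continuous h1.continuous
  have hM0 : 0 ≤ M := (norm_nonneg _).trans (hM 0)
  have hs : ContDiff ℝ (⊤ : ℕ∞) (fun q => ρ (A q)) := hρs.comp A.contDiff
  refine ⟨(M + 1) * 3 ^ L.length, by positivity, fun p hp q => ?_⟩
  have hp' : (1 : ℝ) ≤ p := by exact_mod_cast hp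
  have e : dl L (fun q => ρ ((p : ℝ)⁻¹ • A q)) q = ((p : ℝ)⁻¹) ^ L.length • h ((p : ℝ)⁻¹ • A q) := by
    have := congrFun (dl_scale L hs (p : ℝ)⁻¹) q
    simp only [map_smul] at this
    rw [this, h3]; simp only [map_smul]
  constructor
  · by_cases hq : 3 * (p : ℝ) < jb (A q)
    · rw [dl_eq_zero L (cut_zero hρ0 hp A q hq), norm_zero]
      have := jb_pos (A q)
      positivity
    · push Not at hq
      rw [e, norm_smul, Real.rpow_neg (jb_pos _).le, Real.rpow_natCast, norm_pow, norm_inv,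
        Real.norm_natCast, ← inv_pow, mul_assoc, ← mul_pow, mul_comm]
      have hj := jb_pos (A q)
      apply mul_le_mul ((hM _).trans (by linarith)) _ (by positivity) (by positivity)
      apply pow_le_pow_left₀ (by positivity)
      rw [← div_eq_mul_inv, le_div_iff₀ hj, ← div_eq_inv_mul, div_le_iff₀ (by positivity)]
      exact hq
  · intro hv
    rw [e, h4 (Or.inr hv)]
    simp

lemma len_eq (L : List (Fin n ⊕ Fin n)) : L.length = nx L + ny L := by
  induction L with
  | nil => rfl
  | cons v L ih =>
    have e1 : nx (v :: L) = nx [v] + nx L := nx_append [v] L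
    have e2 : ny (v :: L) = ny [v] + ny L := ny_append [v] L
    rw [e1, e2, List.length_cons, ih]
    rcases v with v | v <;> simp [nx, ny] <;> ring

lemma fam_cut_y {ρ : (Fin n → ℝ) → ℝ} (hρs : ContDiff ℝ (⊤ : ℕ∞) ρ) (hρc : HasCompactSupport ρ)
    (hρ0 : ∀ x : Fin n → ℝ, (4 : ℝ) ≤ ∑ i, (x i) ^ 2 → ρ x = 0) (σ : ℝ) :
    Fam σ 0 0 (fun p (q : (Fin n → ℝ) × (Fin n → ℝ)) => ρ ((p : ℝ)⁻¹ • q.2)) := by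
  refine ⟨fun p => by fun_prop, fun L => ?_⟩
  obtain ⟨C, hC, h⟩ := cut_bound hρs hρc hρ0 (ContinuousLinearMap.snd ℝ _ _) L
  refine ⟨C, hC, fun p hp q => ?_⟩
  obtain ⟨h1, h2⟩ := h p hp q
  simp only [ContinuousLinearMap.coe_snd'] at h1 h2
  have hj1 := jb_pos q.1
  have hj2 := jb_pos q.2
  by_cases hL : nx L = 0
  · have : L.length = ny L := by rw [len_eq, hL, zero_add]
    rw [this] at h1
    simpa [hL] using h1
  · have : ∃ v ∈ L, (bdir v).2 = 0 := by
      obtain ⟨v, hv, hv'⟩ := List.countP_pos_iff.1 (Nat.pos_of_ne_zero hL)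
      refine ⟨v, hv, ?_⟩
      rcases v with v | v
      · rfl
      · simp at hv'
    rw [h2 this, norm_zero]
    positivity

lemma fam_cut_x {ρ : (Fin n → ℝ) → ℝ} (hρs : ContDiff ℝ (⊤ : ℕ∞) ρ) (hρc : HasCompactSupport ρ)
    (hρ0 : ∀ x : Fin n → ℝ, (4 : ℝ) ≤ ∑ i, (x i) ^ 2 → ρ x = 0) {σ : ℝ} (hσ : σ ≤ 1) :
    Fam σ 0 0 (fun p (q : (Fin n → ℝ) × (Fin n → ℝ)) => ρ ((p : ℝ)⁻¹ • q.1)) := by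
  refine ⟨fun p => by fun_prop, fun L => ?_⟩
  obtain ⟨C, hC, h⟩ := cut_bound hρs hρc hρ0 (ContinuousLinearMap.fst ℝ _ _) L
  refine ⟨C, hC, fun p hp q => ?_⟩
  obtain ⟨h1, h2⟩ := h p hp q
  simp only [ContinuousLinearMap.coe_fst'] at h1 h2
  have hj1 := jb_pos q.1
  have hj2 := jb_pos q.2
  by_cases hL : ny L = 0
  · have : L.length = nx L := by rw [len_eq, hL, add_zero]
    rw [this] at h1
    simp only [hL, Nat.cast_zero, sub_zero, Real.rpow_zero, mul_one, zero_sub]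
    refine h1.trans (mul_le_mul_of_nonneg_left ?_ hC.le)
    apply Real.rpow_le_rpow_of_exponent_le (jb_ge _)
    have : (0 : ℝ) ≤ nx L := Nat.cast_nonneg _
    nlinarith
  · have : ∃ v ∈ L, (bdir v).1 = 0 := by
      obtain ⟨v, hv, hv'⟩ := List.countP_pos_iff.1 (Nat.pos_of_ne_zero hL)
      refine ⟨v, hv, ?_⟩
      rcases v with v | v
      · simp at hv'
      · rfl
    rw [h2 this, norm_zero]
    positivity

lemma fam_one (σ : ℝ) : Fam σ 0 0 (fun _ (_ : (Fin n → ℝ) × (Fin n → ℝ)) => (1 : ℝ)) := by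
  refine ⟨fun p => contDiff_const, fun L => ⟨1, one_pos, fun p hp q => ?_⟩⟩
  have hj1 := jb_pos q.1
  have hj2 := jb_pos q.2
  cases L with
  | nil => simp [dl, nx, ny]
  | cons v L =>
    have : dd v (fun _ : (Fin n → ℝ) × (Fin n → ℝ) => (1 : ℝ)) = fun _ => 0 := by
      funext q; simp [dd]
    simp only [dl]
    rw [this, dl_zero, norm_zero]
    positivity

lemma decay (C c ε : ℝ) (hc : 0 < c) (hε : 0 < ε) :
    ∃ P : ℕ, ∀ p : ℕ, P ≤ p → C * (p : ℝ) ^ (-c) ≤ ε := by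
  have h := ((tendsto_rpow_neg_atTop hc).comp tendsto_natCast_atTop_atTop).const_mul C
  rw [mul_zero] at h
  have := h.eventually_le_const hε
  exact eventually_atTop.1 this

lemma rpow_change {j R s t : ℝ} (h1 : 1 ≤ j) (h2 : j ≤ R) : j ^ s ≤ R ^ |s - t| * j ^ t := by
  have hj : 0 < j := by linarith
  have : j ^ s = j ^ (s - t) * j ^ t := by rw [← Real.rpow_add hj]; ring_nf
  rw [this]
  apply mul_le_mul_of_nonneg_right _ (by positivity)
  exact (Real.rpow_le_rpow_of_exponent_le h1 (le_abs_self _)).trans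
    (Real.rpow_le_rpow hj.le h2 (abs_nonneg _))

end helpers

/-- Density of cut-off approximations in symbol spaces: the truncations
`a_p` are symbols of every order, and `a_p → a` in the topology of `S_σ^{l',m'}`
whenever `l' > l`, `m' > m`. -/
theorem statement6 {n : ℕ} {E : Type*} [NormedAddCommGroup E] [NormedSpace ℝ E]
    [FiniteDimensional ℝ E]
    (σ l m l' m' : ℝ) (hσ : σ ∈ Set.Icc (0 : ℝ) 1) (hl : l < l') (hm : m < m')
    (a : (Fin n → ℝ) → (Fin n → ℝ) → E) (ha : Ssym σ l m a)
    (ρ : (Fin n → ℝ) → ℝ) (hρs : ContDiff ℝ (⊤ : ℕ∞) ρ) (hρc : HasCompactSupport ρ)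
    (hρr : ∀ x, ρ x ∈ Set.Icc (0 : ℝ) 1)
    (hρ1 : ∀ x : Fin n → ℝ, (∑ i, (x i) ^ 2) < 1 → ρ x = 1)
    (hρ0 : ∀ x : Fin n → ℝ, (4 : ℝ) ≤ ∑ i, (x i) ^ 2 → ρ x = 0) :
    (∀ p : ℕ, 1 ≤ p → ∀ l'' m'' : ℝ,
      Ssym σ l'' m'' (fun x ϑ =>
        ((if σ = 0 then 1 else ρ ((p : ℝ)⁻¹ • x)) * ρ ((p : ℝ)⁻¹ • ϑ)) • a x ϑ)) ∧
    (∀ (α β : Fin n → ℕ) (ε : ℝ), 0 < ε → ∃ P : ℕ, ∀ p : ℕ, P ≤ p → ∀ x ϑ,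
      jb x ^ (σ * ((msize α : ℝ) - l')) * jb ϑ ^ ((msize β : ℝ) - m') *
        ‖pdm2 α β (fun x ϑ => a x ϑ -
          ((if σ = 0 then 1 else ρ ((p : ℝ)⁻¹ • x)) * ρ ((p : ℝ)⁻¹ • ϑ)) • a x ϑ) x ϑ‖
        ≤ ε) := by
  classical
  have hk : Fam σ 0 0 (fun p (q : (Fin n → ℝ) × (Fin n → ℝ)) =>
      if σ = 0 then (1 : ℝ) else ρ ((p : ℝ)⁻¹ • q.1)) := by
    by_cases h0 : σ = 0
    · simp only [h0, if_true]; exact fam_one 0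
    · simp only [h0, if_false]; exact fam_cut_x hρs hρc hρ0 hσ.2
  have hF := fam_smul (fam_smul hk (fam_cut_y hρs hρc hρ0 σ)) (fam_const ha)
  simp only [add_zero, zero_add, smul_eq_mul] at hF
  constructor
  · intro p hp l'' m''
    refine ⟨hF.1 p, fun α β => ?_⟩
    obtain ⟨C, hC, h⟩ := hF.2 (lab α β)
    have hp' : (1 : ℝ) ≤ p := by exact_mod_cast hp
    refine ⟨C * (3 * (p : ℝ)) ^ |σ * (l - (msize α : ℝ)) - σ * (l'' - (msize α : ℝ))| *
      (3 * (p : ℝ)) ^ |(m - (msize β : ℝ)) - (m'' - (msize β : ℝ))|, by positivity, fun x ϑ => ?_⟩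
    rw [pdm2_eq α β (hF.1 p)]
    have hx := jb_pos x
    have hϑ := jb_pos ϑ
    by_cases h1 : 3 * (p : ℝ) < jb ϑ
    · have := cut_zero hρ0 hp (ContinuousLinearMap.snd ℝ _ _) (x, ϑ) h1
      rw [dl_eq_zero, norm_zero]
      · positivity
      · filter_upwards [this] with y hy
        simp only [ContinuousLinearMap.coe_snd'] at hy
        rw [hy, mul_zero, zero_smul]
    by_cases h2 : σ ≠ 0 ∧ 3 * (p : ℝ) < jb x
    · have := cut_zero hρ0 hp (ContinuousLinearMap.fst ℝ _ _) (x, ϑ) h2.2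
      rw [dl_eq_zero, norm_zero]
      · positivity
      · filter_upwards [this] with y hy
        simp only [ContinuousLinearMap.coe_fst'] at hy
        rw [if_neg h2.1, hy, zero_mul, zero_smul]
    have b := h p hp (x, ϑ)
    rw [nx_lab, ny_lab] at b
    refine b.trans ?_
    have c1 : jb x ^ (σ * (l - (msize α : ℝ))) ≤
        (3 * (p : ℝ)) ^ |σ * (l - (msize α : ℝ)) - σ * (l'' - (msize α : ℝ))| *
          jb x ^ (σ * (l'' - (msize α : ℝ))) := by
      by_cases h0 : σ = 0
      · simp [h0]
      · apply rpow_change (jb_ge x)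
        by_contra h3
        exact h2 ⟨h0, not_le.1 h3⟩
    have c2 := rpow_change (s := m - (msize β : ℝ)) (t := m'' - (msize β : ℝ))
      (jb_ge ϑ) (not_lt.1 h1)
    calc C * jb x ^ (σ * (l - (msize α : ℝ))) * jb ϑ ^ (m - (msize β : ℝ))
        ≤ C * ((3 * (p : ℝ)) ^ |σ * (l - (msize α : ℝ)) - σ * (l'' - (msize α : ℝ))| *
          jb x ^ (σ * (l'' - (msize α : ℝ)))) *
          ((3 * (p : ℝ)) ^ |(m - (msize β : ℝ)) - (m'' - (msize β : ℝ))| *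
            jb ϑ ^ (m'' - (msize β : ℝ))) := by gcongr
      _ = _ := by ring
  · intro α β ε hε
    obtain ⟨C, hC, h⟩ := hF.2 (lab α β)
    obtain ⟨C', hC', h'⟩ := (fam_const ha).2 (lab α β)
    obtain ⟨P1, hP1⟩ := decay (C' + C) (m' - m) ε (by linarith) hε
    have : ∃ P : ℕ, σ ≠ 0 → ∀ p : ℕ, P ≤ p → (C' + C) * (p : ℝ) ^ (-(σ * (l' - l))) ≤ ε := by
      by_cases h0 : σ = 0
      · exact ⟨0, fun h => absurd h0 h⟩
      · have : 0 < σ := lt_of_le_of_ne hσ.1 (Ne.symm h0)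
        obtain ⟨P, hP⟩ := decay (C' + C) (σ * (l' - l)) ε (mul_pos this (by linarith)) hε
        exact ⟨P, fun _ => hP⟩
    obtain ⟨P2, hP2⟩ := this
    refine ⟨max 1 (max P1 P2), fun p hp x ϑ => ?_⟩
    have hp1 : 1 ≤ p := (le_max_left _ _).trans hp
    have hp2 : P1 ≤ p := (le_max_left _ _).trans ((le_max_right _ _).trans hp)
    have hp3 : P2 ≤ p := (le_max_right _ _).trans ((le_max_right _ _).trans hp)
    have hp' : (1 : ℝ) ≤ p := by exact_mod_cast hp1
    have hp0 : (0 : ℝ) < p := by linarith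
    have hx := jb_pos x
    have hϑ := jb_pos ϑ
    rw [pdm2_eq α β (ha.1.sub (hF.1 p))]
    by_cases hz : jb ϑ < p ∧ (σ ≠ 0 → jb x < p)
    · have z1 := cut_one hρ1 hp1 (ContinuousLinearMap.snd ℝ _ _) (x, ϑ) hz.1
      have z2 : ∀ᶠ y in nhds (x, ϑ),
          (if σ = 0 then (1 : ℝ) else ρ ((p : ℝ)⁻¹ • y.1)) = 1 := by
        by_cases h0 : σ = 0
        · simp [h0]
        · simp only [h0, if_false]
          exact cut_one hρ1 hp1 (ContinuousLinearMap.fst ℝ _ _) (x, ϑ) (hz.2 h0)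
      rw [dl_eq_zero, norm_zero, mul_zero]
      · exact hε.le
      · filter_upwards [z1, z2] with y hy1 hy2
        simp only [ContinuousLinearMap.coe_snd'] at hy1
        rw [hy1, hy2]
        simp
    rw [dl_sub _ ha.1 (hF.1 p)]
    have b := (norm_sub_le _ _).trans (add_le_add (h' p hp1 (x, ϑ)) (h p hp1 (x, ϑ)))
    rw [nx_lab, ny_lab] at b
    have key : jb x ^ (σ * ((msize α : ℝ) - l')) * jb ϑ ^ ((msize β : ℝ) - m') *
        (C' * jb x ^ (σ * (l - (msize α : ℝ))) * jb ϑ ^ (m - (msize β : ℝ)) +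
          C * jb x ^ (σ * (l - (msize α : ℝ))) * jb ϑ ^ (m - (msize β : ℝ))) =
        (C' + C) * (jb x ^ (-(σ * (l' - l))) * jb ϑ ^ (-(m' - m))) := by
      rw [show -(σ * (l' - l)) = σ * ((msize α : ℝ) - l') + σ * (l - (msize α : ℝ)) by ring,
        show -(m' - m) = ((msize β : ℝ) - m') + (m - (msize β : ℝ)) by ring,
        Real.rpow_add hx, Real.rpow_add hϑ]
      ring
    refine (mul_le_mul_of_nonneg_left b (by positivity)).trans ?_
    refine key.le.trans ?_
    have u1 : jb x ^ (-(σ * (l' - l))) ≤ 1 :=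
      Real.rpow_le_one_of_one_le_of_nonpos (jb_ge x)
        (neg_nonpos.2 (mul_nonneg hσ.1 (by linarith)))
    have u2 : jb ϑ ^ (-(m' - m)) ≤ 1 :=
      Real.rpow_le_one_of_one_le_of_nonpos (jb_ge ϑ) (by linarith)
    by_cases h1 : jb ϑ < p
    · have h2 : σ ≠ 0 ∧ (p : ℝ) ≤ jb x := by
        by_contra h3
        exact hz ⟨h1, fun h0 => not_le.1 fun h4 => h3 ⟨h0, h4⟩⟩
      refine le_trans ?_ (hP2 h2.1 p hp3)
      apply mul_le_mul_of_nonneg_left _ (by positivity)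
      have : jb x ^ (-(σ * (l' - l))) ≤ (p : ℝ) ^ (-(σ * (l' - l))) :=
        Real.rpow_le_rpow_of_nonpos hp0 h2.2 (neg_nonpos.2 (mul_nonneg hσ.1 (by linarith)))
      calc _ ≤ (p : ℝ) ^ (-(σ * (l' - l))) * 1 := by gcongr
        _ = _ := mul_one _
    · refine le_trans ?_ (hP1 p hp2)
      apply mul_le_mul_of_nonneg_left _ (by positivity)
      have : jb ϑ ^ (-(m' - m)) ≤ (p : ℝ) ^ (-(m' - m)) :=
        Real.rpow_le_rpow_of_nonpos hp0 (not_lt.1 h1) (by linarith)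
      calc _ ≤ 1 * (p : ℝ) ^ (-(m' - m)) := by gcongr
        _ = _ := one_mul _
end
end

section
/- Let N ∈ ℕ*, let f₁, f₂, f₃ : ℕ^{3n} → ℝ be such that there exists ρ < 1 with sup_{β∈ℕ^n} ( f₃(0,β,0) - ρ|β| ) < ∞, and let a : ℝ^{3n} → M_N(ℂ) be smooth with, for every 3n-multi-index ν = (α,β,γ), a finite best constant q_ν^f(a) such that ‖∂^ν a(x,ζ,ϑ)‖ ≤ q_ν^f(a) ⟨x⟩^{f₁(ν)} ⟨ζ⟩^{f₂(ν)} ⟨ϑ⟩^{f₃(ν)} for all (x,ζ,ϑ). Then for every u ∈ S(ℝ^{2n}, M_N(ℂ)): (a) for each (x,ϑ) the integral R(x,ϑ) := ∫_{ℝ^n} e^{2πi⟨ϑ,ζ⟩} Tr( a(x,ζ,ϑ) u(x,ζ)^* ) dζ converges absolutely; (b) (x,ϑ) ↦ R(x,ϑ) is absolutely integrable on ℝ^{2n}, so that ⟨I(a), u⟩ := ∫_{ℝ^n}∫_{ℝ^n} R(x,ϑ) dϑ dx is well defined; (c) there exist p, M ∈ ℕ and C > 0, depending only on n, f and ρ (not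 on a or u), such that |⟨I(a), u⟩| ≤ C Σ_{0≤|β|≤p} Σ_{β'≤2β} q_{(0,β',0)}^f(a) · q_{M,(0,2β-β')}(u), where q_{M,μ}(u) := sup_{(x,ζ)} ⟨(x,ζ)⟩^{M} ‖∂^μ u(x,ζ)‖. In particular u ↦ ⟨I(a), u⟩ is a continuous (anti)linear form on S(ℝ^{2n}, M_N(ℂ)), i.e. a tempered distribution, and for fixed u the map a ↦ ⟨I(a), u⟩ is continuous with respect to the seminorms q_ν^f. -/
open MeasureTheory
open scoped BigOperators

noncomputable section

attribute [local instance] Matrix.normedAddCommGroup Matrix.normedSpace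

lemma h_one_le_jb {n : ℕ} (v : Fin n → ℝ) : 1 ≤ jb v := by
  unfold jb
  rw [Real.one_le_sqrt]
  have : 0 ≤ ∑ i, (v i) ^ 2 := Finset.sum_nonneg fun i _ => sq_nonneg _
  linarith

lemma h_jb_pos {n : ℕ} (v : Fin n → ℝ) : 0 < jb v := lt_of_lt_of_le one_pos (h_one_le_jb v)

lemma h_jb_sq {n : ℕ} (v : Fin n → ℝ) : jb v ^ 2 = 1 + ∑ i, (v i) ^ 2 := by
  unfold jb
  rw [Real.sq_sqrt]
  have : 0 ≤ ∑ i, (v i) ^ 2 := Finset.sum_nonneg fun i _ => sq_nonneg _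
  linarith

lemma h_jb_cont {n : ℕ} : Continuous (jb : (Fin n → ℝ) → ℝ) := by
  unfold jb
  fun_prop

lemma h_norm_le_jb {n : ℕ} (v : Fin n → ℝ) : (1 + ‖v‖) / 2 ≤ jb v := by
  have h1 := h_one_le_jb v
  have h2 : ‖v‖ ≤ jb v := by
    rw [pi_norm_le_iff_of_nonneg (h_jb_pos v).le]
    intro i
    rw [Real.norm_eq_abs]
    refine abs_le_of_sq_le_sq ?_ (h_jb_pos v).le
    rw [h_jb_sq]
    have := Finset.single_le_sum (f := fun i => (v i) ^ 2) (fun i _ => sq_nonneg _)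
      (Finset.mem_univ i)
    linarith
  linarith

lemma h_jb_le_jb2 {n m : ℕ} (x : Fin n → ℝ) (y : Fin m → ℝ) : jb x ≤ jb2 x y := by
  unfold jb jb2
  apply Real.sqrt_le_sqrt
  have : 0 ≤ ∑ i, (y i) ^ 2 := Finset.sum_nonneg fun i _ => sq_nonneg _
  linarith

lemma h_jb_le_jb2' {n m : ℕ} (x : Fin n → ℝ) (y : Fin m → ℝ) : jb y ≤ jb2 x y := by
  unfold jb jb2
  apply Real.sqrt_le_sqrt
  have : 0 ≤ ∑ i, (x i) ^ 2 := Finset.sum_nonneg fun i _ => sq_nonneg _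
  linarith

lemma h_jb2_le {n : ℕ} (q : (Fin n → ℝ) × (Fin n → ℝ)) :
    jb2 q.1 q.2 ≤ (1 + 2 * n) * (1 + ‖q‖) := by
  unfold jb2
  rw [Real.sqrt_le_left (by positivity)]
  have key : ∀ v : Fin n → ℝ, ‖v‖ ≤ ‖q‖ → ∑ i, (v i) ^ 2 ≤ n * ‖q‖ ^ 2 := by
    intro v hv
    calc ∑ i, (v i) ^ 2 ≤ ∑ i : Fin n, ‖q‖ ^ 2 := by
          apply Finset.sum_le_sum
          intro i _
          rw [← sq_abs]
          have := (norm_le_pi_norm v i).trans hv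
          rw [Real.norm_eq_abs] at this
          gcongr
      _ = _ := by simp
  have h1 := key q.1 (norm_fst_le q)
  have h2 := key q.2 (norm_snd_le q)
  have h3 : 0 ≤ ‖q‖ := norm_nonneg q
  have h4 : (0:ℝ) ≤ n := Nat.cast_nonneg n
  calc _ ≤ 1 + n * ‖q‖ ^ 2 + n * ‖q‖ ^ 2 := by linarith
    _ ≤ (1 + 2 * n) * (1 + ‖q‖) ^ 2 := by nlinarith [mul_nonneg h4 h3, mul_nonneg h3 h3]
    _ ≤ (1 + 2 * n) ^ 2 * (1 + ‖q‖) ^ 2 := by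
      gcongr
      nlinarith
    _ = _ := by ring

/-- integrable weight -/
def wt {n : ℕ} (v : Fin n → ℝ) : ℝ := (jb v ^ (n + 1))⁻¹

lemma h_wt_pos {n : ℕ} (v : Fin n → ℝ) : 0 < wt v := by
  unfold wt
  have := h_jb_pos v
  positivity

lemma h_wt_cont {n : ℕ} : Continuous (wt : (Fin n → ℝ) → ℝ) := by
  unfold wt
  refine (h_jb_cont.pow _).inv₀ fun v => ?_
  exact (pow_pos (h_jb_pos v) _).ne'

lemma h_wt_int {n : ℕ} : Integrable (wt : (Fin n → ℝ) → ℝ) := by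
  have h := integrable_one_add_norm (E := Fin n → ℝ) (μ := volume) (r := (n + 1 : ℕ))
    (by simp)
  refine (h.const_mul (2 ^ (n + 1))).mono' h_wt_cont.aestronglyMeasurable ?_
  refine Filter.Eventually.of_forall fun v => ?_
  rw [Real.norm_of_nonneg (h_wt_pos v).le, Real.rpow_neg (by positivity), Real.rpow_natCast, wt]
  have h1 := h_norm_le_jb v
  have h2 : ((1 + ‖v‖) / 2) ^ (n + 1) ≤ jb v ^ (n + 1) := by gcongr
  calc (jb v ^ (n + 1))⁻¹ ≤ (((1 + ‖v‖) / 2) ^ (n + 1))⁻¹ := by gcongr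
    _ = _ := by rw [div_pow, inv_div]; rfl

lemma h_pdm_list {n : ℕ} {E : Type*} [NormedAddCommGroup E] [NormedSpace ℝ E]
    (i : Fin n) (k : ℕ) (f : (Fin n → ℝ) → E) (l : List (Fin n)) (hl : l.Nodup) :
    l.foldr (fun j g => (pd j)^[(Pi.single i k : Fin n → ℕ) j] g) f =
      if i ∈ l then (pd i)^[k] f else f := by
  induction l with
  | nil => simp
  | cons j l ih =>
    rw [List.nodup_cons] at hl
    rw [List.foldr_cons, ih hl.2]
    by_cases hij : j = i
    · subst hij
      simp [hl.1]
    · simp [Ne.symm hij]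

lemma h_pdm_single {n : ℕ} {E : Type*} [NormedAddCommGroup E] [NormedSpace ℝ E]
    (i : Fin n) (k : ℕ) (f : (Fin n → ℝ) → E) :
    pdm (Pi.single i k) f = (pd i)^[k] f := by
  unfold pdm
  rw [h_pdm_list i k f _ (List.nodup_finRange n)]
  simp

lemma h_pdm_zero {n : ℕ} {E : Type*} [NormedAddCommGroup E] [NormedSpace ℝ E]
    (f : (Fin n → ℝ) → E) : pdm 0 f = f := by
  unfold pdm
  induction (List.finRange n) with
  | nil => rfl
  | cons j l ih => rw [List.foldr_cons, ih]; rfl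

lemma h_pd_smooth {n : ℕ} {E : Type*} [NormedAddCommGroup E] [NormedSpace ℝ E]
    (i : Fin n) (f : (Fin n → ℝ) → E) (hf : ContDiff ℝ (⊤ : ℕ∞) f) :
    ContDiff ℝ (⊤ : ℕ∞) (pd i f) := by
  unfold pd
  exact (hf.fderiv_right (m := (⊤ : ℕ∞)) (by simp)).clm_apply contDiff_const

lemma h_pdk_smooth {n : ℕ} {E : Type*} [NormedAddCommGroup E] [NormedSpace ℝ E]
    (i : Fin n) (k : ℕ) (f : (Fin n → ℝ) → E) (hf : ContDiff ℝ (⊤ : ℕ∞) f) :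
    ContDiff ℝ (⊤ : ℕ∞) ((pd i)^[k] f) := by
  induction k with
  | zero => exact hf
  | succ k ih => rw [Function.iterate_succ_apply']; exact h_pd_smooth i _ ih

/-- partial derivatives of a slice of a Schwartz function -/
lemma h_schw_slice {n : ℕ} {E : Type*} [NormedAddCommGroup E] [NormedSpace ℝ E]
    (i : Fin n) (l : ℕ) (u : SchwartzMap ((Fin n → ℝ) × (Fin n → ℝ)) E) :
    ∃ w : SchwartzMap ((Fin n → ℝ) × (Fin n → ℝ)) E, ∀ x,
      (pd i)^[l] (fun ζ => u (x, ζ)) = fun ζ => w (x, ζ) := by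
  induction l with
  | zero => exact ⟨u, fun x => rfl⟩
  | succ l ih =>
    obtain ⟨w, hw⟩ := ih
    refine ⟨LineDeriv.lineDerivOp ((0, Pi.single i 1) : (Fin n → ℝ) × (Fin n → ℝ)) w, fun x => ?_⟩
    rw [Function.iterate_succ_apply', hw x]
    funext ζ
    rw [SchwartzMap.lineDerivOp_apply_eq_fderiv]
    unfold pd
    have h1 : HasFDerivAt (fun ζ : Fin n → ℝ => (x, ζ))
        (ContinuousLinearMap.inr ℝ (Fin n → ℝ) (Fin n → ℝ)) ζ := hasFDerivAt_prodMk_right x ζ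
    have h2 : HasFDerivAt w (fderiv ℝ w (x, ζ)) (x, ζ) := w.differentiableAt.hasFDerivAt
    have h3 : HasFDerivAt (fun ζ => w (x, ζ)) _ ζ := h2.comp ζ h1
    rw [h3.fderiv]
    simp

lemma h_schw_bdd {n : ℕ} {E : Type*} [NormedAddCommGroup E] [NormedSpace ℝ E]
    (M : ℕ) (u : SchwartzMap ((Fin n → ℝ) × (Fin n → ℝ)) E) :
    ∃ D : ℝ, ∀ q : (Fin n → ℝ) × (Fin n → ℝ), jb2 q.1 q.2 ^ M * ‖u q‖ ≤ D := by
  have h := SchwartzMap.one_add_le_sup_seminorm_apply (𝕜 := ℝ) (m := (M, 0)) (k := M) (n := 0)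
    le_rfl le_rfl u
  simp only [norm_iteratedFDeriv_zero] at h
  refine ⟨(1 + 2 * n) ^ M * (2 ^ M * ((Finset.Iic (M, 0)).sup
    fun m => SchwartzMap.seminorm ℝ m.1 m.2) u), fun q => ?_⟩
  have h0 : 0 ≤ jb2 q.1 q.2 := Real.sqrt_nonneg _
  calc jb2 q.1 q.2 ^ M * ‖u q‖ ≤ ((1 + 2 * n) * (1 + ‖q‖)) ^ M * ‖u q‖ := by
        gcongr
        exact h_jb2_le q
    _ = (1 + 2 * n) ^ M * ((1 + ‖q‖) ^ M * ‖u q‖) := by rw [mul_pow, mul_assoc]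
    _ ≤ _ := by
        exact mul_le_mul_of_nonneg_left (h q) (by positivity)

/-- the phase -/
def ph {n : ℕ} (ϑ ζ : Fin n → ℝ) : ℂ := Complex.exp (2 * Real.pi * Complex.I * (ip ϑ ζ : ℂ))

lemma h_ph_norm {n : ℕ} (ϑ ζ : Fin n → ℝ) : ‖ph ϑ ζ‖ = 1 := by
  unfold ph
  rw [show 2 * Real.pi * Complex.I * (ip ϑ ζ : ℂ) = ((2 * Real.pi * ip ϑ ζ : ℝ) : ℂ) * Complex.I by
    push_cast; ring]
  exact Complex.norm_exp_ofReal_mul_I _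

lemma h_ph_cont {n : ℕ} : Continuous (fun q : (Fin n → ℝ) × (Fin n → ℝ) => ph q.1 q.2) := by
  unfold ph ip
  fun_prop

lemma h_ph_cont' {n : ℕ} (ϑ : Fin n → ℝ) : Continuous (ph ϑ) := by
  unfold ph ip
  fun_prop

lemma h_ph_deriv {n : ℕ} (ϑ ζ : Fin n → ℝ) :
    DifferentiableAt ℝ (ph ϑ) ζ ∧
    ∀ i, fderiv ℝ (ph ϑ) ζ (Pi.single i 1) = 2 * Real.pi * Complex.I * (ϑ i : ℂ) * ph ϑ ζ := by
  let L : (Fin n → ℝ) →L[ℝ] ℝ := ∑ i, ϑ i • ContinuousLinearMap.proj (R := ℝ) i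
  have hL : ∀ v, L v = ip ϑ v := by intro v; simp [L, ip]
  have h1 : HasFDerivAt (fun v => ((L v : ℝ) : ℂ)) (Complex.ofRealCLM.comp L) ζ :=
    (Complex.ofRealCLM.comp L).hasFDerivAt
  have h2 := (h1.const_mul (2 * Real.pi * Complex.I)).cexp
  have h3 : ph ϑ = fun v => Complex.exp (2 * Real.pi * Complex.I * ((L v : ℝ) : ℂ)) := by
    funext v; rw [hL]; rfl
  rw [h3]
  refine ⟨h2.differentiableAt, fun i => ?_⟩
  rw [h2.fderiv]
  have : L (Pi.single i 1) = ϑ i := by simp [hL, ip, Pi.single_apply]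
  simp [this]
  ring

lemma h_int_ph {n : ℕ} (ϑ : Fin n → ℝ) (g : (Fin n → ℝ) → ℂ) (hg : Integrable g) :
    Integrable (fun ζ => ph ϑ ζ * g ζ) :=
  hg.bdd_mul (c := 1) (h_ph_cont' ϑ).aestronglyMeasurable
    (Filter.Eventually.of_forall fun ζ => (h_ph_norm ϑ ζ).le)

/-- one integration by parts -/
lemma h_ibp {n : ℕ} {E : Type*} [NormedAddCommGroup E] [NormedSpace ℝ E]
    (T : E →L[ℝ] E →L[ℝ] ℂ) (i : Fin n) (ϑ : Fin n → ℝ) (A U : (Fin n → ℝ) → E)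
    (hA : ContDiff ℝ (⊤ : ℕ∞) A) (hU : ContDiff ℝ (⊤ : ℕ∞) U)
    (h00 : Integrable (fun ζ => T (A ζ) (U ζ)))
    (h10 : Integrable (fun ζ => T (pd i A ζ) (U ζ)))
    (h01 : Integrable (fun ζ => T (A ζ) (pd i U ζ))) :
    2 * Real.pi * Complex.I * (ϑ i : ℂ) * (∫ ζ, ph ϑ ζ * T (A ζ) (U ζ)) =
      -((∫ ζ, ph ϑ ζ * T (pd i A ζ) (U ζ)) + ∫ ζ, ph ϑ ζ * T (A ζ) (pd i U ζ)) := by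
  have hAd : Differentiable ℝ A := hA.differentiable (by simp)
  have hUd : Differentiable ℝ U := hU.differentiable (by simp)
  have hder : ∀ ζ, HasFDerivAt (fun ζ => T (A ζ) (U ζ))
      ((T.precompR _ (A ζ) (fderiv ℝ U ζ)) + (T.precompL _ (fderiv ℝ A ζ) (U ζ))) ζ := fun ζ =>
    T.hasFDerivAt_of_bilinear (hAd ζ).hasFDerivAt (hUd ζ).hasFDerivAt
  have hder' : ∀ ζ, fderiv ℝ (fun ζ => T (A ζ) (U ζ)) ζ (Pi.single i 1) =
      T (pd i A ζ) (U ζ) + T (A ζ) (pd i U ζ) := by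
    intro ζ
    rw [(hder ζ).fderiv]
    simp [pd, add_comm]
  have key := integral_mul_fderiv_eq_neg_fderiv_mul_of_integrable (μ := (volume : Measure (Fin n → ℝ)))
    (f := ph ϑ) (g := fun ζ => T (A ζ) (U ζ)) (v := Pi.single i 1) (𝕜 := ℂ) ?_ ?_ ?_
    (fun x _ => (h_ph_deriv ϑ x).1) (fun x _ => (hder x).differentiableAt)
  · simp only [hder', (h_ph_deriv ϑ _).2, mul_add] at key
    rw [integral_add (h_int_ph ϑ _ h10) (h_int_ph ϑ _ h01)] at key
    rw [key, neg_neg, ← integral_const_mul]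
    congr 1
    funext ζ
    ring
  · simp only [(h_ph_deriv ϑ _).2]
    refine ((h_int_ph ϑ _ h00).const_mul (2 * Real.pi * Complex.I * (ϑ i : ℂ))).congr ?_
    exact Filter.Eventually.of_forall fun ζ => by simp only; ring
  · simp only [hder', mul_add]
    exact (h_int_ph ϑ _ h10).add (h_int_ph ϑ _ h01)
  · exact h_int_ph ϑ _ h00

/-- iterated integration by parts, as an estimate -/
lemma h_ibp_iter {n : ℕ} {E : Type*} [NormedAddCommGroup E] [NormedSpace ℝ E]
    (T : E →L[ℝ] E →L[ℝ] ℂ) (i : Fin n) (ϑ : Fin n → ℝ) (A U : (Fin n → ℝ) → E)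
    (hA : ContDiff ℝ (⊤ : ℕ∞) A) (hU : ContDiff ℝ (⊤ : ℕ∞) U)
    (hI : ∀ k l, Integrable (fun ζ => T ((pd i)^[k] A ζ) ((pd i)^[l] U ζ)))
    (D : ℝ) (m : ℕ) : ∀ k l : ℕ,
    (∀ j ≤ m, ‖∫ ζ, ph ϑ ζ * T ((pd i)^[k + j] A ζ) ((pd i)^[l + (m - j)] U ζ)‖ ≤ D) →
    |2 * Real.pi * ϑ i| ^ m * ‖∫ ζ, ph ϑ ζ * T ((pd i)^[k] A ζ) ((pd i)^[l] U ζ)‖ ≤ 2 ^ m * D := by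
  induction m with
  | zero => intro k l h; simpa using h 0 le_rfl
  | succ m ih =>
    intro k l h
    have e := h_ibp T i ϑ _ _ (h_pdk_smooth i k A hA) (h_pdk_smooth i l U hU) (hI k l)
      (by simpa only [Function.iterate_succ_apply'] using hI (k + 1) l)
      (by simpa only [Function.iterate_succ_apply'] using hI k (l + 1))
    rw [← Function.iterate_succ_apply' (pd i), ← Function.iterate_succ_apply' (pd i)] at e
    have h1 := ih (k + 1) l (fun j hj => by
      have := h (j + 1) (by omega)
      rwa [show k + (j + 1) = k + 1 + j by omega, show m + 1 - (j + 1) = m - j by omega] at this)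
    have h2 := ih k (l + 1) (fun j hj => by
      have := h j (by omega)
      rwa [show l + (m + 1 - j) = l + 1 + (m - j) by omega] at this)
    have e2 := congrArg norm e
    rw [norm_mul, norm_neg] at e2
    have e3 : ‖2 * Real.pi * Complex.I * (ϑ i : ℂ)‖ = |2 * Real.pi * ϑ i| := by
      simp [abs_mul]
    rw [e3] at e2
    calc _ = |2 * Real.pi * ϑ i| ^ m * (|2 * Real.pi * ϑ i| *
          ‖∫ ζ, ph ϑ ζ * T ((pd i)^[k] A ζ) ((pd i)^[l] U ζ)‖) := by ring
      _ ≤ |2 * Real.pi * ϑ i| ^ m * (‖∫ ζ, ph ϑ ζ * T ((pd i)^[k + 1] A ζ) ((pd i)^[l] U ζ)‖ +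
          ‖∫ ζ, ph ϑ ζ * T ((pd i)^[k] A ζ) ((pd i)^[l + 1] U ζ)‖) := by
        rw [e2]
        gcongr
        exact norm_add_le _ _
      _ ≤ 2 ^ m * D + 2 ^ m * D := by rw [mul_add]; exact add_le_add h1 h2
      _ = _ := by ring

lemma h_jb_cases {n : ℕ} (v : Fin n → ℝ) :
    jb v ^ 2 ≤ n + 1 ∨ ∃ i, jb v ^ 2 ≤ (n + 1) * |v i| ^ 2 := by
  rw [h_jb_sq]
  by_cases h : ∀ i, |v i| ≤ 1
  · left
    have : ∑ i, (v i) ^ 2 ≤ ∑ i : Fin n, (1:ℝ) := by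
      apply Finset.sum_le_sum
      intro i _
      rw [← sq_abs]
      exact pow_le_one₀ (abs_nonneg _) (h i)
    simp at this
    linarith
  · right
    push Not at h
    obtain ⟨i₀, h₀⟩ := h
    obtain ⟨i, -, hi⟩ := Finset.exists_max_image Finset.univ (fun i => |v i|) ⟨i₀, Finset.mem_univ _⟩
    refine ⟨i, ?_⟩
    have h1 : 1 ≤ |v i| := h₀.le.trans (hi i₀ (Finset.mem_univ _))
    have : ∑ j, (v j) ^ 2 ≤ ∑ j : Fin n, |v i| ^ 2 := by
      apply Finset.sum_le_sum
      intro j _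
      rw [← sq_abs]
      have := hi j (Finset.mem_univ _)
      gcongr
    simp only [Finset.sum_const, Finset.card_univ, Fintype.card_fin, nsmul_eq_mul] at this
    have := one_le_pow₀ h1 (n := 2)
    linarith

/-- The trace pairing as a continuous real-bilinear map -/
lemma h_trace_pairing (N : ℕ) : ∃ T : Matrix (Fin N) (Fin N) ℂ →L[ℝ] Matrix (Fin N) (Fin N) ℂ →L[ℝ] ℂ,
    (∀ A B, T A B = Matrix.trace (A * Matrix.conjTranspose B)) ∧
    ∀ A B, ‖T A B‖ ≤ (N : ℝ) ^ 2 * ‖A‖ * ‖B‖ := by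
  let T₀ : Matrix (Fin N) (Fin N) ℂ →ₗ[ℝ] Matrix (Fin N) (Fin N) ℂ →ₗ[ℝ] ℂ :=
    LinearMap.mk₂ ℝ (fun A B => Matrix.trace (A * Matrix.conjTranspose B))
      (by intro a b c; simp [add_mul]) (by intro a b c; simp)
      (by intro a b c; simp [mul_add]) (by intro a b c; simp)
  have hb : ∀ A B, ‖T₀ A B‖ ≤ (N : ℝ) ^ 2 * ‖A‖ * ‖B‖ := by
    intro A B
    have : T₀ A B = ∑ i, ∑ j, A i j * star (B i j) := by
      simp [T₀, Matrix.trace, Matrix.mul_apply]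
    rw [this]
    calc _ ≤ ∑ i : Fin N, ∑ j : Fin N, ‖A‖ * ‖B‖ := by
          refine (norm_sum_le _ _).trans (Finset.sum_le_sum fun i _ => ?_)
          refine (norm_sum_le _ _).trans (Finset.sum_le_sum fun j _ => ?_)
          rw [norm_mul, norm_star]
          gcongr
          · exact Matrix.norm_entry_le_entrywise_sup_norm A
          · exact Matrix.norm_entry_le_entrywise_sup_norm B
      _ = _ := by simp; ring
  exact ⟨T₀.mkContinuous₂ _ hb, fun A B => rfl, hb⟩

lemma h_rpow_le {s t : ℝ} (hs : 1 ≤ s) (hst : s ≤ t) {f : ℝ} {L : ℕ} (hf : f ≤ L) :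
    s ^ f ≤ t ^ L :=
  calc s ^ f ≤ s ^ (L : ℝ) := Real.rpow_le_rpow_of_exponent_le hs hf
    _ = s ^ L := Real.rpow_natCast _ _
    _ ≤ t ^ L := by gcongr

lemma h_term_bound {n : ℕ} {E : Type*} [NormedAddCommGroup E] [NormedSpace ℝ E]
    (T : E →L[ℝ] E →L[ℝ] ℂ) (c : ℝ) (hc : 0 ≤ c) (hT : ∀ A B, ‖T A B‖ ≤ c * ‖A‖ * ‖B‖)
    (L : ℕ) (x ζ ϑ : Fin n → ℝ) (A U : E) (qc f1 f2 f3 e Q S : ℝ) (hqc : 0 ≤ qc)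
    (hA : ‖A‖ ≤ qc * jb x ^ f1 * jb ζ ^ f2 * jb ϑ ^ f3)
    (h1 : f1 ≤ L) (h2 : f2 ≤ L) (h3 : f3 ≤ e)
    (hU : jb2 x ζ ^ (2 * L + 2 * (n + 1)) * ‖U‖ ≤ Q) (hS : qc * Q ≤ S) :
    ‖T A U‖ ≤ c * S * jb ϑ ^ e * wt x * wt ζ := by
  have hx1 := h_one_le_jb x
  have hζ1 := h_one_le_jb ζ
  have hϑ1 := h_one_le_jb ϑ
  have hx := h_jb_le_jb2 x ζ
  have hζ := h_jb_le_jb2' x ζ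
  have hj : 0 < jb2 x ζ := by linarith
  have hw1 := h_wt_pos x
  have hw2 := h_wt_pos ζ
  have hQ : 0 ≤ Q := le_trans (by positivity) hU
  have hE : 0 < jb ϑ ^ e := Real.rpow_pos_of_pos (by linarith) _
  have hA' : ‖A‖ ≤ qc * jb2 x ζ ^ L * jb2 x ζ ^ L * jb ϑ ^ e := by
    refine hA.trans ?_
    have a1 := h_rpow_le hx1 hx h1
    have a2 := h_rpow_le hζ1 hζ h2
    have a3 : jb ϑ ^ f3 ≤ jb ϑ ^ e := Real.rpow_le_rpow_of_exponent_le hϑ1 h3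
    have p1 : 0 ≤ jb x ^ f1 := Real.rpow_nonneg (by linarith) _
    have p2 : 0 ≤ jb ζ ^ f2 := Real.rpow_nonneg (by linarith) _
    have p3 : 0 ≤ jb ϑ ^ f3 := Real.rpow_nonneg (by linarith) _
    gcongr
  have hW : jb2 x ζ ^ (2 * L) * ‖U‖ ≤ Q * (wt x * wt ζ) := by
    have b1 : jb x ^ (n + 1) * jb ζ ^ (n + 1) ≤ jb2 x ζ ^ (2 * (n + 1)) := by
      rw [show jb2 x ζ ^ (2 * (n + 1)) = jb2 x ζ ^ (n + 1) * jb2 x ζ ^ (n + 1) by ring]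
      gcongr
    have b2 : (wt x * wt ζ) * (jb x ^ (n + 1) * jb ζ ^ (n + 1)) = 1 := by
      unfold wt
      have : jb x ^ (n + 1) ≠ 0 := (pow_pos (by linarith) _).ne'
      have : jb ζ ^ (n + 1) ≠ 0 := (pow_pos (by linarith) _).ne'
      field_simp
    calc jb2 x ζ ^ (2 * L) * ‖U‖
        = (wt x * wt ζ) * (jb x ^ (n + 1) * jb ζ ^ (n + 1)) * (jb2 x ζ ^ (2 * L) * ‖U‖) := by
          rw [b2, one_mul]
      _ ≤ (wt x * wt ζ) * (jb2 x ζ ^ (2 * (n + 1))) * (jb2 x ζ ^ (2 * L) * ‖U‖) := by gcongr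
      _ = (wt x * wt ζ) * (jb2 x ζ ^ (2 * L + 2 * (n + 1)) * ‖U‖) := by ring
      _ ≤ (wt x * wt ζ) * Q := by gcongr
      _ = _ := by ring
  calc ‖T A U‖ ≤ c * ‖A‖ * ‖U‖ := hT A U
    _ ≤ c * (qc * jb2 x ζ ^ L * jb2 x ζ ^ L * jb ϑ ^ e) * ‖U‖ := by gcongr
    _ = c * qc * jb ϑ ^ e * (jb2 x ζ ^ (2 * L) * ‖U‖) := by ring
    _ ≤ c * qc * jb ϑ ^ e * (Q * (wt x * wt ζ)) := by gcongr
    _ = c * (qc * Q) * jb ϑ ^ e * wt x * wt ζ := by ring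
    _ ≤ _ := by gcongr

lemma h_int_gen {n : ℕ} {E : Type*} [NormedAddCommGroup E] [NormedSpace ℝ E]
    (T : E →L[ℝ] E →L[ℝ] ℂ) (c : ℝ) (hc : 0 ≤ c) (hT : ∀ A B, ‖T A B‖ ≤ c * ‖A‖ * ‖B‖)
    (x ϑ : Fin n → ℝ) (A : (Fin n → ℝ) → E) (hAc : Continuous A)
    (w : SchwartzMap ((Fin n → ℝ) × (Fin n → ℝ)) E) (qc f1 f2 f3 : ℝ) (hqc : 0 ≤ qc)
    (hA : ∀ ζ, ‖A ζ‖ ≤ qc * jb x ^ f1 * jb ζ ^ f2 * jb ϑ ^ f3) :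
    Integrable (fun ζ => T (A ζ) (w (x, ζ))) := by
  obtain ⟨L, hL⟩ := exists_nat_ge (max f1 f2)
  obtain ⟨Q, hQ⟩ := h_schw_bdd (2 * L + 2 * (n + 1)) w
  have hwc : Continuous (fun ζ => w (x, ζ)) := w.continuous.comp (by fun_prop)
  refine (h_wt_int.const_mul (c * (qc * Q) * jb ϑ ^ f3 * wt x)).mono'
    ((T.continuous.comp hAc).clm_apply hwc).aestronglyMeasurable
    (Filter.Eventually.of_forall fun ζ => ?_)
  exact h_term_bound T c hc hT L x ζ ϑ (A ζ) (w (x, ζ)) qc f1 f2 f3 f3 Q (qc * Q) hqc (hA ζ)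
    ((le_max_left _ _).trans hL) ((le_max_right _ _).trans hL) le_rfl (hQ (x, ζ)) le_rfl

set_option maxHeartbeats 4000000 in
/-- The oscillatory pairing
`⟨I(a), u⟩ = ∫∫∫ e^{2πi⟨ϑ,ζ⟩} Tr(a(x,ζ,ϑ) u(x,ζ)^*) dζ dϑ dx` is well defined for any
`a ∈ 𝒪_f` (with `sup_β (f₃(0,β,0) - ρ|β|) < ∞` for some `ρ < 1`), with a bound
by finitely many seminorms of `a` and `u`, uniformly in `a` and `u`. -/
theorem statement8 {n N : ℕ} (hN : 0 < N)
    (f₁ f₂ f₃ : (Fin n → ℕ) → (Fin n → ℕ) → (Fin n → ℕ) → ℝ)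
    (ρ : ℝ) (hρ : ρ < 1)
    (hf3 : ∃ B : ℝ, ∀ β : Fin n → ℕ, f₃ 0 β 0 - ρ * (msize β : ℝ) ≤ B) :
    ∃ p M : ℕ, ∃ C > 0,
      ∀ (a : (Fin n → ℝ) → (Fin n → ℝ) → (Fin n → ℝ) → Matrix (Fin N) (Fin N) ℂ)
        (qc : (Fin n → ℕ) → (Fin n → ℕ) → (Fin n → ℕ) → ℝ),
        ContDiff ℝ (⊤ : ℕ∞)
          (fun q : ((Fin n → ℝ) × (Fin n → ℝ)) × (Fin n → ℝ) => a q.1.1 q.1.2 q.2) →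
        (∀ α β γ, 0 ≤ qc α β γ) →
        (∀ α β γ, ∀ x ζ ϑ, ‖pdm3 α β γ a x ζ ϑ‖ ≤
          qc α β γ * jb x ^ (f₁ α β γ) * jb ζ ^ (f₂ α β γ) * jb ϑ ^ (f₃ α β γ)) →
        ∀ u : SchwartzMap ((Fin n → ℝ) × (Fin n → ℝ)) (Matrix (Fin N) (Fin N) ℂ),
          (∀ x ϑ, Integrable (fun ζ =>
            Complex.exp (2 * Real.pi * Complex.I * (ip ϑ ζ : ℂ)) *
              Matrix.trace (a x ζ ϑ * Matrix.conjTranspose (u (x, ζ))))) ∧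
          Integrable (fun q : (Fin n → ℝ) × (Fin n → ℝ) =>
            ∫ ζ, Complex.exp (2 * Real.pi * Complex.I * (ip q.2 ζ : ℂ)) *
              Matrix.trace (a q.1 ζ q.2 * Matrix.conjTranspose (u (q.1, ζ)))) ∧
          ‖∫ x, ∫ ϑ, ∫ ζ, Complex.exp (2 * Real.pi * Complex.I * (ip ϑ ζ : ℂ)) *
              Matrix.trace (a x ζ ϑ * Matrix.conjTranspose (u (x, ζ)))‖ ≤
            C * ∑ β ∈ Finset.univ.filter
                (fun β : Fin n → Fin (p + 1) => (∑ i, (β i : ℕ)) ≤ p),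
              ∑ β' ∈ Finset.univ.filter
                  (fun β' : Fin n → Fin (2 * p + 1) => ∀ i, (β' i : ℕ) ≤ 2 * (β i : ℕ)),
                qc 0 (fun i => (β' i : ℕ)) 0 *
                  (⨆ q : (Fin n → ℝ) × (Fin n → ℝ),
                    jb2 q.1 q.2 ^ M *
                      ‖pdm2 0 (fun i => 2 * (β i : ℕ) - (β' i : ℕ))
                        (fun x ζ => u (x, ζ)) q.1 q.2‖) := by
  obtain ⟨T, hTeq, hTb⟩ := h_trace_pairing N
  obtain ⟨B, hB⟩ := hf3
  set r := max ρ 0 with hr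
  have hr1 : r < 1 := max_lt hρ one_pos
  have hr0 : 0 ≤ r := le_max_right _ _
  have hρr : ρ ≤ r := le_max_left _ _
  set B0 := max B 0 with hB0
  have hB00 : 0 ≤ B0 := le_max_right _ _
  have hBB : B ≤ B0 := le_max_left _ _
  obtain ⟨p, hp⟩ := exists_nat_ge ((B0 + n + 1) / (2 * (1 - r)))
  rw [div_le_iff₀ (by linarith)] at hp
  set e : ℝ := B0 + 2 * p * r with he
  have hf3e : ∀ i : Fin n, ∀ k ≤ 2 * p, f₃ 0 (Pi.single i k) 0 ≤ e := by
    intro i k hk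
    have h := hB (Pi.single i k)
    have hm : msize (Pi.single i k : Fin n → ℕ) = k := by simp [msize]
    rw [hm] at h
    have hk' : (k : ℝ) ≤ 2 * p := by exact_mod_cast hk
    have h1 : ρ * k ≤ r * k := by gcongr
    have h2 : r * k ≤ r * (2 * p) := by gcongr
    rw [he]; linarith
  have hf3e0 : f₃ 0 0 0 ≤ e := by
    have h := hB 0
    have hm : msize (0 : Fin n → ℕ) = 0 := by simp [msize]
    rw [hm] at h
    have : 0 ≤ 2 * p * r := by positivity
    rw [he]; push_cast at h; linarith
  obtain ⟨L, hL⟩ : ∃ L : ℕ, ∀ β' : Fin n → Fin (2 * p + 1),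
      f₁ 0 (fun i => (β' i : ℕ)) 0 ≤ L ∧ f₂ 0 (fun i => (β' i : ℕ)) 0 ≤ L := by
    obtain ⟨L0, hL0⟩ := (Set.finite_range (fun β' : Fin n → Fin (2 * p + 1) =>
      max (f₁ 0 (fun i => (β' i : ℕ)) 0) (f₂ 0 (fun i => (β' i : ℕ)) 0))).bddAbove
    obtain ⟨L, hL⟩ := exists_nat_ge L0
    refine ⟨L, fun β' => ?_⟩
    have := (hL0 ⟨β', rfl⟩).trans hL
    exact ⟨(le_max_left _ _).trans this, (le_max_right _ _).trans this⟩
  set I0 : ℝ := ∫ v : Fin n → ℝ, wt v with hI0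
  have hI00 : 0 ≤ I0 := integral_nonneg fun v => (h_wt_pos v).le
  set c : ℝ := (N : ℝ) ^ 2 with hc
  have hc0 : 0 ≤ c := by positivity
  set K : ℝ := ((n : ℝ) + 1) ^ p * 2 ^ (2 * p) * c * I0 with hK
  have hK0 : 0 ≤ K := by positivity
  refine ⟨p, 2 * L + 2 * (n + 1), K * I0 * I0 + 1, by positivity, ?_⟩
  intro a qc ha hqc0 hqc u
  set S : ℝ := ∑ β ∈ Finset.univ.filter
                (fun β : Fin n → Fin (p + 1) => (∑ i, (β i : ℕ)) ≤ p),
              ∑ β' ∈ Finset.univ.filter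
                  (fun β' : Fin n → Fin (2 * p + 1) => ∀ i, (β' i : ℕ) ≤ 2 * (β i : ℕ)),
                qc 0 (fun i => (β' i : ℕ)) 0 *
                  (⨆ q : (Fin n → ℝ) × (Fin n → ℝ),
                    jb2 q.1 q.2 ^ (2 * L + 2 * (n + 1)) *
                      ‖pdm2 0 (fun i => 2 * (β i : ℕ) - (β' i : ℕ))
                        (fun x ζ => u (x, ζ)) q.1 q.2‖) with hS
  have hterm0 : ∀ (b : Fin n → ℕ) (m : Fin n → ℕ), 0 ≤ qc 0 b 0 *
      (⨆ q : (Fin n → ℝ) × (Fin n → ℝ), jb2 q.1 q.2 ^ (2 * L + 2 * (n + 1)) *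
        ‖pdm2 0 m (fun x ζ => u (x, ζ)) q.1 q.2‖) := by
    intro b m
    refine mul_nonneg (hqc0 _ _ _) (Real.iSup_nonneg fun q => ?_)
    have : 0 ≤ jb2 q.1 q.2 := Real.sqrt_nonneg _
    positivity
  have hS0 : 0 ≤ S := Finset.sum_nonneg fun β _ => Finset.sum_nonneg fun β' _ => hterm0 _ _
  have hle : ∀ (β : Fin n → Fin (p + 1)) (β' : Fin n → Fin (2 * p + 1)),
      (∑ i, (β i : ℕ)) ≤ p → (∀ i, (β' i : ℕ) ≤ 2 * (β i : ℕ)) →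
      qc 0 (fun i => (β' i : ℕ)) 0 *
      (⨆ q : (Fin n → ℝ) × (Fin n → ℝ), jb2 q.1 q.2 ^ (2 * L + 2 * (n + 1)) *
        ‖pdm2 0 (fun i => 2 * (β i : ℕ) - (β' i : ℕ)) (fun x ζ => u (x, ζ)) q.1 q.2‖) ≤ S := by
    intro β β' h1 h2
    refine le_trans ?_ (Finset.single_le_sum (f := fun β : Fin n → Fin (p + 1) =>
      ∑ β' ∈ Finset.univ.filter
                  (fun β' : Fin n → Fin (2 * p + 1) => ∀ i, (β' i : ℕ) ≤ 2 * (β i : ℕ)),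
                qc 0 (fun i => (β' i : ℕ)) 0 *
                  (⨆ q : (Fin n → ℝ) × (Fin n → ℝ),
                    jb2 q.1 q.2 ^ (2 * L + 2 * (n + 1)) *
                      ‖pdm2 0 (fun i => 2 * (β i : ℕ) - (β' i : ℕ))
                        (fun x ζ => u (x, ζ)) q.1 q.2‖))
      (fun β _ => Finset.sum_nonneg fun β' _ => hterm0 _ _)
      (Finset.mem_filter.mpr ⟨Finset.mem_univ β, h1⟩))
    exact Finset.single_le_sum (f := fun β' : Fin n → Fin (2 * p + 1) =>
                qc 0 (fun i => (β' i : ℕ)) 0 *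
                  (⨆ q : (Fin n → ℝ) × (Fin n → ℝ),
                    jb2 q.1 q.2 ^ (2 * L + 2 * (n + 1)) *
                      ‖pdm2 0 (fun i => 2 * (β i : ℕ) - (β' i : ℕ))
                        (fun x ζ => u (x, ζ)) q.1 q.2‖))
      (fun β' _ => hterm0 _ _)
      (Finset.mem_filter.mpr ⟨Finset.mem_univ β', h2⟩)
  clear_value S
  -- slices
  have hasm : ∀ x ϑ, ContDiff ℝ (⊤ : ℕ∞) (fun ζ => a x ζ ϑ) := fun x ϑ =>
    ha.comp (f := fun ζ : Fin n → ℝ => ((x, ζ), ϑ)) (by fun_prop)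
  have husm : ∀ x, ContDiff ℝ (⊤ : ℕ∞) (fun ζ => u (x, ζ)) := fun x =>
    (u.smooth (⊤ : ℕ∞)).comp (f := fun ζ : Fin n → ℝ => (x, ζ)) (by fun_prop)
  have hak : ∀ i k x ζ ϑ, pdm3 0 (Pi.single i k) 0 a x ζ ϑ = (pd i)^[k] (fun ζ => a x ζ ϑ) ζ := by
    intro i k x ζ ϑ
    simp only [pdm3, h_pdm_zero, h_pdm_single]
  have ha0 : ∀ x ζ ϑ, pdm3 0 0 0 a x ζ ϑ = a x ζ ϑ := by
    intro x ζ ϑ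
    simp only [pdm3, h_pdm_zero]
  have huk : ∀ i k x ζ, pdm2 0 (Pi.single i k) (fun x ζ => u (x, ζ)) x ζ =
      (pd i)^[k] (fun ζ => u (x, ζ)) ζ := by
    intro i k x ζ
    simp only [pdm2, h_pdm_zero, h_pdm_single]
  have hu0 : ∀ x ζ, pdm2 0 0 (fun x ζ => u (x, ζ)) x ζ = u (x, ζ) := by
    intro x ζ
    simp only [pdm2, h_pdm_zero]
  have hI : ∀ i x ϑ k l, Integrable (fun ζ =>
      T ((pd i)^[k] (fun ζ => a x ζ ϑ) ζ) ((pd i)^[l] (fun ζ => u (x, ζ)) ζ)) := by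
    intro i x ϑ k l
    obtain ⟨w, hw⟩ := h_schw_slice i l u
    rw [hw x]
    refine h_int_gen T c hc0 hTb x ϑ _ (h_pdk_smooth i k _ (hasm x ϑ)).continuous w _
      (f₁ 0 (Pi.single i k) 0) (f₂ 0 (Pi.single i k) 0) (f₃ 0 (Pi.single i k) 0)
      (hqc0 0 (Pi.single i k) 0) (fun ζ => ?_)
    rw [← hak]
    exact hqc 0 (Pi.single i k) 0 x ζ ϑ
  have hI' : ∀ x ϑ, Integrable (fun ζ => T (a x ζ ϑ) (u (x, ζ))) := by
    intro x ϑ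
    refine h_int_gen T c hc0 hTb x ϑ (fun ζ => a x ζ ϑ) (hasm x ϑ).continuous u _
      (f₁ 0 0 0) (f₂ 0 0 0) (f₃ 0 0 0)
      (hqc0 0 0 0) (fun ζ => ?_)
    rw [← ha0]
    exact hqc 0 0 0 x ζ ϑ
  -- pointwise bounds of integrands
  have hb0 : ∀ x ζ ϑ, ‖T (a x ζ ϑ) (u (x, ζ))‖ ≤ c * S * jb ϑ ^ e * wt x * wt ζ := by
    intro x ζ ϑ
    obtain ⟨Q, hQ⟩ := h_schw_bdd (2 * L + 2 * (n + 1)) u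
    have h := hle 0 0 (by simp) (by simp)
    have hL0 := hL 0
    refine h_term_bound T c hc0 hTb L x ζ ϑ _ _ (qc 0 0 0) _ _ _ e _ S (hqc0 0 0 0)
      (by rw [← ha0]; exact hqc 0 0 0 x ζ ϑ) hL0.1 hL0.2 hf3e0 ?_ h
    refine le_trans ?_ (le_ciSup (f := fun q : (Fin n → ℝ) × (Fin n → ℝ) =>
      jb2 q.1 q.2 ^ (2 * L + 2 * (n + 1)) *
        ‖pdm2 0 (fun i => 2 * (((0 : Fin n → Fin (p + 1)) i : Fin (p + 1)) : ℕ) -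
          (((0 : Fin n → Fin (2 * p + 1)) i : Fin (2 * p + 1)) : ℕ))
          (fun x ζ => u (x, ζ)) q.1 q.2‖) ?_ (x, ζ))
    · exact le_of_eq (by rw [← hu0]; rfl)
    · refine ⟨Q, ?_⟩
      rintro _ ⟨q, rfl⟩
      refine le_trans (le_of_eq ?_) (hQ q)
      simp only
      rw [← hu0]; rfl
  have hbi : ∀ i, ∀ k ≤ 2 * p, ∀ x ζ ϑ,
      ‖T ((pd i)^[k] (fun ζ => a x ζ ϑ) ζ) ((pd i)^[2 * p - k] (fun ζ => u (x, ζ)) ζ)‖ ≤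
        c * S * jb ϑ ^ e * wt x * wt ζ := by
    intro i k hk x ζ ϑ
    obtain ⟨w, hw⟩ := h_schw_slice i (2 * p - k) u
    obtain ⟨Q, hQ⟩ := h_schw_bdd (2 * L + 2 * (n + 1)) w
    set β : Fin n → Fin (p + 1) := Pi.single i ⟨p, by omega⟩ with hβ
    set β' : Fin n → Fin (2 * p + 1) := Pi.single i ⟨k, by omega⟩ with hβ'
    have e1 : (fun j => (β j : ℕ)) = Pi.single i p := by
      funext j
      by_cases hj : j = i
      · subst hj; simp [hβ]
      · simp [hβ, hj]
    have e2 : (fun j => (β' j : ℕ)) = Pi.single i k := by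
      funext j
      by_cases hj : j = i
      · subst hj; simp [hβ']
      · simp [hβ', hj]
    have e1' := fun j => congrFun e1 j
    have e2' := fun j => congrFun e2 j
    have e3 : (fun j => 2 * (β j : ℕ) - (β' j : ℕ)) = Pi.single i (2 * p - k) := by
      funext j
      rw [e1' j, e2' j]
      by_cases hj : j = i
      · subst hj; simp
      · simp [hj]
    have h := hle β β' (by simp only [e1']; simp) (by
      intro j
      rw [e1' j, e2' j]
      by_cases hj : j = i
      · subst hj; simpa using hk
      · simp [hj])
    have hL0 := hL β'
    rw [e2, e3] at h
    rw [e2] at hL0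
    refine h_term_bound T c hc0 hTb L x ζ ϑ _ _ (qc 0 (Pi.single i k) 0) _ _ _ e _ S (hqc0 _ _ _)
      (by rw [← hak]; exact hqc 0 (Pi.single i k) 0 x ζ ϑ) hL0.1 hL0.2 (hf3e i k hk) ?_ h
    rw [← huk]
    refine le_ciSup (f := fun q : (Fin n → ℝ) × (Fin n → ℝ) =>
      jb2 q.1 q.2 ^ (2 * L + 2 * (n + 1)) *
        ‖pdm2 0 (Pi.single i (2 * p - k)) (fun x ζ => u (x, ζ)) q.1 q.2‖) ?_ (x, ζ)
    refine ⟨Q, ?_⟩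
    rintro _ ⟨q, rfl⟩
    refine le_trans (le_of_eq ?_) (hQ q)
    simp only
    rw [huk, hw]
  -- bounds of integrals
  have hint : ∀ (x ϑ : Fin n → ℝ) (g : (Fin n → ℝ) → ℂ),
      (∀ ζ, ‖g ζ‖ ≤ c * S * jb ϑ ^ e * wt x * wt ζ) →
      ‖∫ ζ, ph ϑ ζ * g ζ‖ ≤ c * S * jb ϑ ^ e * wt x * I0 := by
    intro x ϑ g hg
    rw [hI0, ← integral_const_mul]
    refine norm_integral_le_of_norm_le (h_wt_int.const_mul _)
      (Filter.Eventually.of_forall fun ζ => ?_)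
    rw [norm_mul, h_ph_norm, one_mul]
    exact hg ζ
  have hR : ∀ x ϑ, ‖∫ ζ, ph ϑ ζ * T (a x ζ ϑ) (u (x, ζ))‖ ≤ K * S * (wt x * wt ϑ) := by
    intro x ϑ
    set R := ‖∫ ζ, ph ϑ ζ * T (a x ζ ϑ) (u (x, ζ))‖ with hRdef
    set D := c * S * jb ϑ ^ e * wt x * I0 with hD
    have hj := h_jb_pos ϑ
    have hwx := h_wt_pos x
    have hje : 0 < jb ϑ ^ e := Real.rpow_pos_of_pos hj _
    have hD0 : 0 ≤ D := by positivity
    have hR0 : 0 ≤ R := norm_nonneg _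
    have h1 : (jb ϑ ^ 2) ^ p * R ≤ ((n : ℝ) + 1) ^ p * 2 ^ (2 * p) * D := by
      rcases h_jb_cases ϑ with h | ⟨i, h⟩
      · have hRD : R ≤ D := hint x ϑ _ (fun ζ => hb0 x ζ ϑ)
        have h2 : (1 : ℝ) ≤ 2 ^ (2 * p) := one_le_pow₀ (by norm_num)
        calc (jb ϑ ^ 2) ^ p * R ≤ ((n : ℝ) + 1) ^ p * D := by gcongr
          _ = ((n : ℝ) + 1) ^ p * 1 * D := by ring
          _ ≤ _ := by gcongr
      · have h3 := h_ibp_iter T i ϑ _ _ (hasm x ϑ) (husm x) (hI i x ϑ) D (2 * p) 0 0 (by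
          intro j hj
          rw [zero_add, zero_add]
          exact hint x ϑ _ (fun ζ => hbi i j hj x ζ ϑ))
        have h4 : |ϑ i| ≤ |2 * Real.pi * ϑ i| := by
          rw [abs_mul, abs_of_pos (by positivity : 0 < 2 * Real.pi)]
          have := Real.pi_gt_three
          nlinarith [abs_nonneg (ϑ i)]
        calc (jb ϑ ^ 2) ^ p * R ≤ (((n : ℝ) + 1) * |ϑ i| ^ 2) ^ p * R := by gcongr
          _ = ((n : ℝ) + 1) ^ p * (|ϑ i| ^ (2 * p) * R) := by rw [mul_pow, ← pow_mul]; ring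
          _ ≤ ((n : ℝ) + 1) ^ p * (|2 * Real.pi * ϑ i| ^ (2 * p) * R) := by gcongr
          _ ≤ ((n : ℝ) + 1) ^ p * (2 ^ (2 * p) * D) := by
              exact mul_le_mul_of_nonneg_left h3 (by positivity)
          _ = _ := by ring
    have h5 : jb ϑ ^ e ≤ (jb ϑ ^ 2) ^ p * wt ϑ := by
      have : (jb ϑ ^ 2) ^ p * wt ϑ = jb ϑ ^ ((2 * p : ℕ) - (n + 1 : ℕ) : ℝ) := by
        rw [Real.rpow_sub hj, Real.rpow_natCast, Real.rpow_natCast, wt, ← pow_mul, div_eq_mul_inv]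
      rw [this]
      refine Real.rpow_le_rpow_of_exponent_le (h_one_le_jb ϑ) ?_
      push_cast
      rw [he]
      linarith
    have hj2 : 0 < (jb ϑ ^ 2) ^ p := by positivity
    refine le_of_mul_le_mul_left ?_ hj2
    calc (jb ϑ ^ 2) ^ p * R ≤ ((n : ℝ) + 1) ^ p * 2 ^ (2 * p) * D := h1
      _ = K * S * wt x * jb ϑ ^ e := by rw [hD, hK]; ring
      _ ≤ K * S * wt x * ((jb ϑ ^ 2) ^ p * wt ϑ) := by gcongr
      _ = _ := by ring
  simp only [← hTeq]
  refine ⟨fun x ϑ => h_int_ph ϑ _ (hI' x ϑ), ?_, ?_⟩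
  · refine ((h_wt_int.mul_prod h_wt_int).const_mul (K * S)).mono' ?_
      (Filter.Eventually.of_forall fun q => hR q.1 q.2)
    have hcont : Continuous (fun z : ((Fin n → ℝ) × (Fin n → ℝ)) × (Fin n → ℝ) =>
        ph z.1.2 z.2 * T (a z.1.1 z.2 z.1.2) (u (z.1.1, z.2))) := by
      have c1 : Continuous (fun z : ((Fin n → ℝ) × (Fin n → ℝ)) × (Fin n → ℝ) =>
        ph z.1.2 z.2) := h_ph_cont.comp (by fun_prop :
          Continuous fun z : ((Fin n → ℝ) × (Fin n → ℝ)) × (Fin n → ℝ) => (z.1.2, z.2))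
      have c2 : Continuous (fun z : ((Fin n → ℝ) × (Fin n → ℝ)) × (Fin n → ℝ) =>
        a z.1.1 z.2 z.1.2) := ha.continuous.comp (by fun_prop :
          Continuous fun z : ((Fin n → ℝ) × (Fin n → ℝ)) × (Fin n → ℝ) => ((z.1.1, z.2), z.1.2))
      have c3 : Continuous (fun z : ((Fin n → ℝ) × (Fin n → ℝ)) × (Fin n → ℝ) =>
        u (z.1.1, z.2)) := u.continuous.comp (by fun_prop :
          Continuous fun z : ((Fin n → ℝ) × (Fin n → ℝ)) × (Fin n → ℝ) => (z.1.1, z.2))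
      exact c1.mul ((T.continuous.comp c2).clm_apply c3)
    exact (hcont.stronglyMeasurable.integral_prod_right
      (ν := (volume : Measure (Fin n → ℝ)))).aestronglyMeasurable
  · have hin : ∀ x, ‖∫ ϑ, ∫ ζ, ph ϑ ζ * T (a x ζ ϑ) (u (x, ζ))‖ ≤ K * S * I0 * wt x := by
      intro x
      have : K * S * I0 * wt x = ∫ ϑ : Fin n → ℝ, K * S * wt x * wt ϑ := by
        rw [integral_const_mul]; ring
      rw [this]
      refine norm_integral_le_of_norm_le (h_wt_int.const_mul _)
        (Filter.Eventually.of_forall fun ϑ => ?_)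
      rw [mul_assoc (K * S)]
      exact hR x ϑ
    have hout : ‖∫ x, ∫ ϑ, ∫ ζ, ph ϑ ζ * T (a x ζ ϑ) (u (x, ζ))‖ ≤ K * S * I0 * I0 := by
      rw [hI0, ← integral_const_mul, ← hI0]
      exact norm_integral_le_of_norm_le (h_wt_int.const_mul _)
        (Filter.Eventually.of_forall fun x => hin x)
    refine le_trans hout ?_
    nlinarith
end
end
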